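/- arXiv:2505.10068 — 8 statements merged into one kernel-verified Lean document; each statement's English description precedes it below -/
import Mathlib

section
/- Taking subfield subcodes does not commute with the Schur product in general: in F_4 with primitive element α (so α^3 = 1), let C_1 ⊆ F_4^3 be the F_4-span of (1, α, 0) and C_2 ⊆ F_4^3 the F_4-span of (0, α^2, 1). Then the binary subfield subcodes satisfy C_1 ∩ F_2^3 = {0} and C_2 ∩ F_2^3 = {0}, while (C_1 ⋆ C_2) ∩ F_2^3 is the F_2-span of (0,1,0); in particular S(C_1) ⋆ S(C_2) ≠ S(C_1 ⋆ C_2). -/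
/-!
Statement 0: In `F₄ = GaloisField 2 2` with primitive element `α` (`α ^ 3 = 1`, `α ≠ 1`),
let `C₁ = span {(1, α, 0)}` and `C₂ = span {(0, α², 1)}`.  Then the binary subfield
subcodes satisfy `S(C₁) = {0}`, `S(C₂) = {0}`, while `S(C₁ ⋆ C₂)` is the `F₂`-span of
`(0,1,0)`; in particular `S(C₁) ⋆ S(C₂) ≠ S(C₁ ⋆ C₂)`.
-/

noncomputable section

abbrev F4 := GaloisField 2 2

/-- Schur (componentwise) product of two linear codes over `F₄`. -/
def schurProd (C D : Submodule F4 (Fin 3 → F4)) : Submodule F4 (Fin 3 → F4) :=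
  Submodule.span F4 {w | ∃ u ∈ C, ∃ v ∈ D, w = u * v}

/-- The binary subfield subcode `S(C) = C ∩ F₂³`, as a set of vectors of `F₄³`
whose entries lie in the prime subfield `{0, 1}`. -/
def Ssub (C : Submodule F4 (Fin 3 → F4)) : Set (Fin 3 → F4) :=
  {v | v ∈ C ∧ ∀ i, v i = 0 ∨ v i = 1}

theorem mem_schurProd_span_singleton {a b v : Fin 3 → F4} :
    v ∈ schurProd (Submodule.span F4 {a}) (Submodule.span F4 {b}) ↔ ∃ c : F4, c • (a * b) = v := by
  rw [← Submodule.mem_span_singleton]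
  constructor
  · refine fun h => Submodule.span_le.2 ?_ h
    rintro _ ⟨_, hu, _, hw, rfl⟩
    obtain ⟨c, rfl⟩ := Submodule.mem_span_singleton.1 hu
    obtain ⟨d, rfl⟩ := Submodule.mem_span_singleton.1 hw
    exact Submodule.mem_span_singleton.2 ⟨c * d, (smul_mul_smul_comm c a d b).symm⟩
  · refine fun h => Submodule.span_mono ?_ h
    exact Set.singleton_subset_iff.2 ⟨a, Submodule.mem_span_singleton_self a, b,
      Submodule.mem_span_singleton_self b, rfl⟩

/-- If `b` has coordinates `1` and `x ∉ {0, 1}`, then no nonzero multiple of `b` is binary. -/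
theorem Ssub_span_singleton_eq_zero {b : Fin 3 → F4} {i j : Fin 3} (hi : b i = 1)
    (hj0 : b j ≠ 0) (hj1 : b j ≠ 1) : Ssub (Submodule.span F4 {b}) = {0} := by
  ext v
  constructor
  · rintro ⟨hv, hbin⟩
    obtain ⟨c, rfl⟩ := Submodule.mem_span_singleton.1 hv
    have hci := hbin i
    have hcj := hbin j
    simp only [Pi.smul_apply, smul_eq_mul, hi, mul_one] at hci hcj
    rcases hci with rfl | rfl
    · simp
    · simp [hj0, hj1] at hcj
  · rintro rfl
    exact ⟨Submodule.zero_mem _, fun _ => Or.inl rfl⟩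

theorem subfield_subcode_schur_counterexample
    (α : F4) (hα3 : α ^ 3 = 1) (hα1 : α ≠ 1)
    (C1 C2 : Submodule F4 (Fin 3 → F4))
    (hC1 : C1 = Submodule.span F4 {![1, α, 0]})
    (hC2 : C2 = Submodule.span F4 {![0, α ^ 2, 1]}) :
    Ssub C1 = {0} ∧ Ssub C2 = {0} ∧
    Ssub (schurProd C1 C2)
      = (Submodule.span (ZMod 2) ({![0, 1, 0]} : Set (Fin 3 → F4)) :
          Submodule (ZMod 2) (Fin 3 → F4)) ∧
    ((Submodule.span (ZMod 2)
        {w : Fin 3 → F4 | ∃ u ∈ Ssub C1, ∃ v ∈ Ssub C2, w = u * v} :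
          Submodule (ZMod 2) (Fin 3 → F4)) : Set (Fin 3 → F4))
      ≠ Ssub (schurProd C1 C2) := by
  have hα0 : α ≠ 0 := by
    rintro rfl
    simp at hα3
  have hα2 : α ^ 2 ≠ 1 := fun h => hα1 (by rw [← hα3, pow_succ, h, one_mul])
  have hmul : (![1, α, 0] : Fin 3 → F4) * ![0, α ^ 2, 1] = ![0, 1, 0] := by
    ext i
    fin_cases i
    · simp
    · simpa [← pow_succ'] using hα3
    · simp
  have h1 : Ssub C1 = {0} := by
    rw [hC1]
    exact Ssub_span_singleton_eq_zero (i := 0) (j := 1) (by simp) (by simpa) (by simpa)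
  have h2 : Ssub C2 = {0} := by
    rw [hC2]
    exact Ssub_span_singleton_eq_zero (i := 2) (j := 1) (by simp) (by simpa) (by simpa using hα2)
  have h3 : Ssub (schurProd C1 C2)
      = (Submodule.span (ZMod 2) ({![0, 1, 0]} : Set (Fin 3 → F4)) :
          Submodule (ZMod 2) (Fin 3 → F4)) := by
    ext v
    simp only [Ssub, Set.mem_ofPred_eq, hC1, hC2, mem_schurProd_span_singleton, hmul,
      SetLike.mem_coe, Submodule.mem_span_singleton]
    constructor
    · rintro ⟨⟨c, rfl⟩, hbin⟩
      have hc : c = 0 ∨ c = 1 := by simpa using hbin 1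
      rcases hc with rfl | rfl
      · exact ⟨0, by rw [zero_smul, zero_smul]⟩
      · exact ⟨1, by rw [one_smul, one_smul]⟩
    · rintro ⟨c, rfl⟩
      obtain rfl | rfl : c = 0 ∨ c = 1 := by revert c; decide
      · exact ⟨⟨0, by rw [zero_smul, zero_smul]⟩, fun i => Or.inl (by simp)⟩
      · refine ⟨⟨1, by rw [one_smul, one_smul]⟩, fun i => ?_⟩
        rw [one_smul]
        fin_cases i <;> simp
  refine ⟨h1, h2, h3, fun h => ?_⟩
  have hmem : (![0, 1, 0] : Fin 3 → F4) ∈ Ssub (schurProd C1 C2) := by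
    rw [h3]
    exact Submodule.mem_span_singleton_self _
  rw [← h, h1, h2] at hmem
  have hbot : (![0, 1, 0] : Fin 3 → F4) ∈ (⊥ : Submodule (ZMod 2) (Fin 3 → F4)) := by
    refine Submodule.span_le.2 ?_ hmem
    rintro _ ⟨_, rfl, _, rfl, rfl⟩
    simp
  simpa using congrFun ((Submodule.mem_bot _).1 hbot) 1

end
end

section
/- The dual of the subfield subcode of a Schur product need not equal the Schur product of the duals of the subfield subcodes: take q = 16, m = 1, N_1 = 16, J = {1} (so Z = F_16^*, n_J = 15, E_J = {0,1,…,14}), and the binary subfield F_2 ⊆ F_16. Let Δ_1 = {1,2,4,8} and Δ_2 = {0}, both unions of complete cyclotomic sets with respect to F_2. Then S(C^J_{Δ_1} ⋆ C^J_{Δ_2})^⊥ ≠ S(C^J_{Δ_1})^⊥ ⋆ S(C^J_{Δ_2})^⊥ as F_2-linear subspaces of F_2^{15}; indeed the right-hand side equals all of F_2^{15} while the left-hand side is a proper subspace. -/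
attribute [local instance] Classical.propDecidable

open scoped Pointwise

noncomputable section

/-- The evaluation point set `Z = Z₁ × ⋯ × Z_m` of a `J`-affine variety code:
for `j ∈ J`, `Z_j` is the set of roots of `X^(N_j - 1) - 1`; for `j ∉ J`,
`Z_j` is the set of roots of `X^(N_j) - X`. -/
def ZJ (F : Type) [Field F] (m : ℕ) (N : Fin m → ℕ) (J : Set (Fin m)) : Set (Fin m → F) :=
  {P | ∀ j, if j ∈ J then P j ^ (N j - 1) = 1 else P j ^ (N j) = P j}

instance (F : Type) [Field F] [Finite F] (m : ℕ) (N : Fin m → ℕ) (J : Set (Fin m)) :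
    Finite (ZJ F m N J) := Subtype.finite

noncomputable instance (F : Type) [Field F] [Finite F] (m : ℕ) (N : Fin m → ℕ)
    (J : Set (Fin m)) : Fintype (ZJ F m N J) := Fintype.ofFinite _

/-- Evaluation of the monomial `X^a` at the points of `Z`. -/
def evJ (F : Type) [Field F] (m : ℕ) (N : Fin m → ℕ) (J : Set (Fin m))
    (a : Fin m → ℕ) : ZJ F m N J → F :=
  fun P => ∏ j, (P : Fin m → F) j ^ a j

/-- The `J`-affine variety code `C^J_Δ`. -/
def CJ (F : Type) [Field F] (m : ℕ) (N : Fin m → ℕ) (J : Set (Fin m))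
    (Δ : Set (Fin m → ℕ)) : Submodule F (ZJ F m N J → F) :=
  Submodule.span F (evJ F m N J '' Δ)

/-- The exponent set `E_J = {0,…,T₁} × ⋯ × {0,…,T_m}`, where `T_j = N_j - 2`
for `j ∈ J` and `T_j = N_j - 1` otherwise. -/
def EJ (m : ℕ) (N : Fin m → ℕ) (J : Set (Fin m)) : Set (Fin m → ℕ) :=
  {a | ∀ j, a j ≤ (if j ∈ J then N j - 2 else N j - 1)}

/-- The reduction `a ↦ ā` of an exponent vector into `E_J`: for `j ∈ J` reduce
modulo `N_j - 1` into `{0,…,N_j-2}`; for `j ∉ J`, `0 ↦ 0` and otherwise reduce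
modulo `N_j - 1` into `{1,…,N_j-1}`. -/
def barJ (m : ℕ) (N : Fin m → ℕ) (J : Set (Fin m)) (a : Fin m → ℕ) : Fin m → ℕ :=
  fun j =>
    if j ∈ J then a j % (N j - 1)
    else if a j = 0 then 0 else (a j - 1) % (N j - 1) + 1

/-- Schur (componentwise) product of two linear codes. -/
def schur {R F ι : Type} [Field F] [CommSemiring R] [Module R (ι → F)]
    (C D : Submodule R (ι → F)) : Submodule R (ι → F) :=
  Submodule.span R {w | ∃ u ∈ C, ∃ v ∈ D, w = u * v}

/-- Euclidean dual of a linear code over `F`. -/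
def dualCode (F : Type) [Field F] {n : Type} [Fintype n]
    (C : Submodule F (n → F)) : Submodule F (n → F) where
  carrier := {v | ∀ c ∈ C, ∑ i, v i * c i = 0}
  zero_mem' := by
    intro c hc
    simp
  add_mem' := by
    intro a b ha hb c hc
    simp [Pi.add_apply, add_mul, Finset.sum_add_distrib, ha c hc, hb c hc]
  smul_mem' := by
    intro r v hv c hc
    simp [Pi.smul_apply, smul_eq_mul, mul_assoc, ← Finset.mul_sum, hv c hc]

/-- The subfield subcode `S(C) = C ∩ K^n` of an `F`-linear code, as a `K`-linear code. -/
def subfieldSubcode (K : Type) {F n : Type} [Field K] [Field F] [Algebra K F]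
    (C : Submodule F (n → F)) : Submodule K (n → F) where
  carrier := {v | v ∈ C ∧ ∀ i, v i ∈ (algebraMap K F).range}
  zero_mem' := ⟨C.zero_mem, fun i => ⟨0, by simp⟩⟩
  add_mem' := by
    rintro a b ⟨haC, haS⟩ ⟨hbC, hbS⟩
    refine ⟨C.add_mem haC hbC, fun i => ?_⟩
    obtain ⟨x, hx⟩ := haS i
    obtain ⟨y, hy⟩ := hbS i
    exact ⟨x + y, by simp [hx, hy]⟩
  smul_mem' := by
    rintro r v ⟨hvC, hvS⟩
    constructor
    · have h := C.smul_mem (algebraMap K F r) hvC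
      rwa [algebraMap_smul] at h
    · intro i
      obtain ⟨x, hx⟩ := hvS i
      exact ⟨r * x, by simp [map_mul, hx, Pi.smul_apply, Algebra.smul_def]⟩

/-- The Euclidean dual, over the subfield `K`, of a `K`-linear code of length `n`
with entries in (the image of) `K`: vectors with entries in `K` orthogonal to all
codewords. -/
def dualK (K : Type) {F n : Type} [Field K] [Field F] [Algebra K F] [Fintype n]
    (C : Submodule K (n → F)) : Submodule K (n → F) where
  carrier := {v | (∀ i, v i ∈ (algebraMap K F).range) ∧ ∀ c ∈ C, ∑ i, v i * c i = 0}
  zero_mem' := ⟨fun i => ⟨0, by simp⟩, by intro c hc; simp⟩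
  add_mem' := by
    rintro a b ⟨haS, ha⟩ ⟨hbS, hb⟩
    constructor
    · intro i
      obtain ⟨x, hx⟩ := haS i
      obtain ⟨y, hy⟩ := hbS i
      exact ⟨x + y, by simp [hx, hy]⟩
    · intro c hc
      simp [Pi.add_apply, add_mul, Finset.sum_add_distrib, ha c hc, hb c hc]
  smul_mem' := by
    rintro r v ⟨hvS, hv⟩
    constructor
    · intro i
      obtain ⟨x, hx⟩ := hvS i
      exact ⟨r * x, by simp [map_mul, hx, Pi.smul_apply, Algebra.smul_def]⟩
    · intro c hc
      have hv' := hv c hc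
      simp only [Pi.smul_apply, Algebra.smul_def, mul_assoc]
      rw [← Finset.mul_sum, hv', mul_zero]

/-- The vectors all of whose entries lie in (the image of) the subfield `K`. -/
def fieldVectors (K : Type) (F n : Type) [Field K] [Field F] [Algebra K F] :
    Submodule K (n → F) where
  carrier := {v | ∀ i, v i ∈ (algebraMap K F).range}
  zero_mem' := fun i => ⟨0, by simp⟩
  add_mem' := by
    rintro a b haS hbS i
    obtain ⟨x, hx⟩ := haS i
    obtain ⟨y, hy⟩ := hbS i
    exact ⟨x + y, by simp [hx, hy]⟩
  smul_mem' := by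
    rintro r v hvS i
    obtain ⟨x, hx⟩ := hvS i
    exact ⟨r * x, by simp [map_mul, hx, Pi.smul_apply, Algebra.smul_def]⟩


abbrev F16 := GaloisField 2 4

/-- `Z = F₁₆* = { roots of X^15 − 1 }`, the evaluation set. -/
def Zpts : Set F16 := {x | x ^ 15 = 1}

noncomputable instance : Fintype Zpts := Fintype.ofFinite _

/-- Evaluation of `X^a` on `Z`. -/
def ev1 (a : ℕ) : Zpts → F16 := fun P => (P : F16) ^ a

/-- The one-variable `J`-affine variety code `C^J_Δ` (here `J = {1}`). -/
def Cone (Δ : Set ℕ) : Submodule F16 (Zpts → F16) :=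
  Submodule.span F16 (ev1 '' Δ)

lemma card_F16 [Fintype F16] : Fintype.card F16 = 16 := by
  rw [← Nat.card_eq_fintype_card, GaloisField.card 2 4 (by norm_num)]
  norm_num

lemma mem_Zpts_of_ne_zero {x : F16} (hx : x ≠ 0) : x ∈ Zpts := by
  have : Fintype F16 := Fintype.ofFinite _
  have hcard := card_F16
  have h := FiniteField.pow_card_sub_one_eq_one x hx
  rw [hcard] at h
  exact h

lemma ne_zero_of_mem_Zpts {x : F16} (hx : x ∈ Zpts) : x ≠ 0 := by
  rintro rfl
  simp [Zpts] at hx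

lemma exists_notMem_of_card_lt (s : Finset F16) (hs : s.card < 16) : ∃ x, x ∉ s := by
  have : Fintype F16 := Fintype.ofFinite _
  have hcard := card_F16
  by_contra! h
  have := Finset.card_le_card (fun x _ => h x : (Finset.univ : Finset F16) ⊆ s)
  rw [Finset.card_univ] at this
  omega

/-- Codewords of `C_{1,2,4,8}` are evaluations of additive polynomials. -/
lemma apply_add_apply_add_apply_eq_zero {w : Zpts → F16} (hw : w ∈ Cone {1, 2, 4, 8})
    {P Q R : Zpts} (h : (R : F16) = P + Q) : w P + w Q + w R = 0 := by
  induction hw using Submodule.span_induction with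
  | mem w hw =>
    obtain ⟨a, ha, rfl⟩ := hw
    have h2 (x y : F16) : (x + y) ^ 2 = x ^ 2 + y ^ 2 := CharTwo.add_sq x y
    have h4 (x y : F16) : (x + y) ^ 4 = x ^ 4 + y ^ 4 := by
      simp only [h2,
        show ∀ z : F16, z ^ 4 = (z ^ 2) ^ 2 from fun z => pow_mul z 2 2]
    have h8 (x y : F16) : (x + y) ^ 8 = x ^ 8 + y ^ 8 := by
      simp only [h2, h4,
        show ∀ z : F16, z ^ 8 = (z ^ 2) ^ 4 from fun z => pow_mul z 2 4]
    simp only [Set.mem_insert_iff, Set.mem_singleton_iff] at ha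
    rcases ha with rfl | rfl | rfl | rfl <;>
      simp only [ev1, h, pow_one, h2, h4, h8, CharTwo.add_self_eq_zero]
  | zero => simp
  | add u v _ _ hu hv =>
    simp only [Pi.add_apply]
    linear_combination hu + hv
  | smul r u _ hu =>
    simp only [Pi.smul_apply, smul_eq_mul]
    linear_combination r * hu

lemma apply_eq_apply_of_mem_Cone_zero {w : Zpts → F16} (hw : w ∈ Cone {0}) (P Q : Zpts) :
    w P = w Q := by
  rw [Cone, Set.image_singleton, Submodule.mem_span_singleton] at hw
  obtain ⟨r, rfl⟩ := hw
  simp [ev1]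

lemma single_mem_fieldVectors (P : Zpts) :
    (Pi.single P 1 : Zpts → F16) ∈ fieldVectors (ZMod 2) F16 Zpts := by
  intro i
  by_cases h : i = P
  · subst h
    exact ⟨1, by simp⟩
  · exact ⟨0, by simp [h]⟩

lemma fieldVectors_le_of_single_mem {S : Submodule (ZMod 2) (Zpts → F16)}
    (h : ∀ P, (Pi.single P 1 : Zpts → F16) ∈ S) : fieldVectors (ZMod 2) F16 Zpts ≤ S := by
  intro v hv
  choose x hx using hv
  have : v = ∑ P, x P • (Pi.single P 1 : Zpts → F16) := by
    ext i
    simp [Finset.sum_apply, Pi.single_apply, Algebra.smul_def, hx]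
  rw [this]
  exact S.sum_mem fun P _ => S.smul_mem _ (h P)

lemma schur_le_fieldVectors {C D : Submodule (ZMod 2) (Zpts → F16)}
    (hC : C ≤ fieldVectors (ZMod 2) F16 Zpts) (hD : D ≤ fieldVectors (ZMod 2) F16 Zpts) :
    schur C D ≤ fieldVectors (ZMod 2) F16 Zpts := by
  refine Submodule.span_le.2 ?_
  rintro _ ⟨u, hu, v, hv, rfl⟩ i
  exact mul_mem (hC hu i) (hD hv i)

lemma dualK_le_fieldVectors (C : Submodule (ZMod 2) (Zpts → F16)) :
    dualK (ZMod 2) C ≤ fieldVectors (ZMod 2) F16 Zpts := fun _ hv => hv.1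

lemma single_add_single_add_single_mem_dualK {P Q R : Zpts} (h : (R : F16) = P + Q) :
    (Pi.single P 1 + Pi.single Q 1 + Pi.single R 1 : Zpts → F16) ∈
      dualK (ZMod 2) (subfieldSubcode (ZMod 2) (Cone {1, 2, 4, 8})) := by
  refine ⟨Submodule.add_mem _ (Submodule.add_mem _ (single_mem_fieldVectors P)
    (single_mem_fieldVectors Q)) (single_mem_fieldVectors R), fun c hc => ?_⟩
  simpa [add_mul, Finset.sum_add_distrib, Pi.single_apply] using
    apply_add_apply_add_apply_eq_zero hc.1 h

lemma single_add_single_mem_dualK (P Q : Zpts) :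
    (Pi.single P 1 + Pi.single Q 1 : Zpts → F16) ∈
      dualK (ZMod 2) (subfieldSubcode (ZMod 2) (Cone {0})) := by
  refine ⟨Submodule.add_mem _ (single_mem_fieldVectors P) (single_mem_fieldVectors Q),
    fun c hc => ?_⟩
  simp [add_mul, Finset.sum_add_distrib, Pi.single_apply,
    apply_eq_apply_of_mem_Cone_zero hc.1 P Q, CharTwo.add_self_eq_zero]

lemma single_mem_schur_dualK (P : Zpts) :
    (Pi.single P 1 : Zpts → F16) ∈
      schur (dualK (ZMod 2) (subfieldSubcode (ZMod 2) (Cone {1, 2, 4, 8})))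
        (dualK (ZMod 2) (subfieldSubcode (ZMod 2) (Cone {0}))) := by
  obtain ⟨b, hb⟩ := exists_notMem_of_card_lt {0, (P : F16)}
    (Finset.card_le_two.trans_lt (by norm_num))
  obtain ⟨d, hd⟩ := exists_notMem_of_card_lt {0, (P : F16), b, P + b}
    (Finset.card_le_four.trans_lt (by norm_num))
  simp only [Finset.mem_insert, Finset.mem_singleton, not_or] at hb hd
  have hP := ne_zero_of_mem_Zpts P.2
  have hPb : (P : F16) + b ≠ 0 := fun h => hb.2 (CharTwo.add_eq_zero.1 h).symm
  let Q : Zpts := ⟨b, mem_Zpts_of_ne_zero hb.1⟩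
  let R : Zpts := ⟨P + b, mem_Zpts_of_ne_zero hPb⟩
  let T : Zpts := ⟨d, mem_Zpts_of_ne_zero hd.1⟩
  have hPQ : P ≠ Q := fun h => hb.2 (congrArg Subtype.val h).symm
  have hPR : P ≠ R := fun h => hb.1 (by simpa [R] using congrArg Subtype.val h)
  have hTP : T ≠ P := fun h => hd.2.1 (congrArg Subtype.val h)
  have hTQ : T ≠ Q := fun h => hd.2.2.1 (congrArg Subtype.val h)
  have hTR : T ≠ R := fun h => hd.2.2.2 (congrArg Subtype.val h)
  refine Submodule.subset_span ⟨_, single_add_single_add_single_mem_dualK (R := R) (Q := Q) rfl,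
    _, single_add_single_mem_dualK P T, ?_⟩
  ext i
  by_cases h1 : i = P
  · subst h1
    simp [hPQ, hPR, hTP.symm]
  · by_cases h2 : i = T
    · rw [h2]
      simp [hTP, hTQ, hTR]
    · simp [h1, h2]

lemma exists_trace_ne_zero : ∃ x : F16, x + x ^ 2 + x ^ 4 + x ^ 8 ≠ 0 := by
  by_contra! h
  let p : Polynomial F16 := .X + .X ^ 2 + .X ^ 4 + .X ^ 8
  have hdeg : p.natDegree = 8 := by
    simp only [p]
    compute_degree!
  have hp : p ≠ 0 := by
    rintro h0
    simp [h0] at hdeg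
  obtain ⟨x, hx⟩ := exists_notMem_of_card_lt p.roots.toFinset
    ((Multiset.toFinset_card_le _).trans_lt
      ((Polynomial.card_roots' p).trans_lt (by rw [hdeg]; norm_num)))
  apply hx
  simpa [hp, p] using h x

lemma trace_mem_range (x : F16) (hx : x ∈ Zpts) :
    x + x ^ 2 + x ^ 4 + x ^ 8 ∈ (algebraMap (ZMod 2) F16).range := by
  have h15 : x ^ 15 = 1 := hx
  have h2 : (2 : F16) = 0 := CharTwo.two_eq_zero
  have h : (x + x ^ 2 + x ^ 4 + x ^ 8) * (x + x ^ 2 + x ^ 4 + x ^ 8 - 1) = 0 := by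
    linear_combination x * h15 +
      (x ^ 3 + x ^ 5 + x ^ 9 + x ^ 6 + x ^ 10 + x ^ 12) * h2
  rcases mul_eq_zero.1 h with h | h
  · exact ⟨0, by rw [h, map_zero]⟩
  · exact ⟨1, by rw [sub_eq_zero.1 h, map_one]⟩

/-- The binary code `S(C_{1,2,4,8} ⋆ C_0)` contains the nonzero word of traces. -/
lemma exists_mem_subfieldSubcode_schur_apply_ne_zero :
    ∃ c ∈ subfieldSubcode (ZMod 2) (schur (Cone {1, 2, 4, 8}) (Cone {0})),
      ∃ P, c P ≠ 0 := by
  obtain ⟨x, hx⟩ := exists_trace_ne_zero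
  have hx0 : x ≠ 0 := by
    rintro rfl
    simp at hx
  have hmem (a : ℕ) (ha : a ∈ ({1, 2, 4, 8} : Set ℕ)) : ev1 a ∈ Cone {1, 2, 4, 8} :=
    Submodule.subset_span ⟨a, ha, rfl⟩
  refine ⟨ev1 1 + ev1 2 + ev1 4 + ev1 8, ⟨Submodule.subset_span
    ⟨ev1 1 + ev1 2 + ev1 4 + ev1 8, ?_, ev1 0, Submodule.subset_span ⟨0, rfl, rfl⟩, ?_⟩, fun P => ?_⟩,
    ⟨x, mem_Zpts_of_ne_zero hx0⟩, ?_⟩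
  · exact add_mem (add_mem (add_mem (hmem 1 (by simp)) (hmem 2 (by simp)))
      (hmem 4 (by simp))) (hmem 8 (by simp))
  · ext P
    simp [ev1]
  · simpa [ev1] using trace_mem_range P P.2
  · simpa [ev1] using hx

lemma dualK_subfieldSubcode_schur_lt :
    dualK (ZMod 2) (subfieldSubcode (ZMod 2) (schur (Cone {1, 2, 4, 8}) (Cone {0})))
      < fieldVectors (ZMod 2) F16 Zpts := by
  refine lt_of_le_not_ge (dualK_le_fieldVectors _) fun h => ?_
  obtain ⟨c, hc, P, hP⟩ := exists_mem_subfieldSubcode_schur_apply_ne_zero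
  exact hP (by simpa [Pi.single_apply] using (h (single_mem_fieldVectors P)).2 c hc)

/-- for `Δ₁ = {1,2,4,8}` and `Δ₂ = {0}` (unions of complete
2-cyclotomic sets mod 15), we have
`S(C^J_{Δ₁} ⋆ C^J_{Δ₂})^⊥ ≠ S(C^J_{Δ₁})^⊥ ⋆ S(C^J_{Δ₂})^⊥`; indeed the right-hand
side is all of `F₂^15` while the left-hand side is a proper subspace. -/
theorem dual_subfieldSubcode_schur_ne
    (Δ1 Δ2 : Set ℕ) (hΔ1 : Δ1 = {1, 2, 4, 8}) (hΔ2 : Δ2 = {0})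
    (hc1 : ∀ a ∈ Δ1, 2 * a % 15 ∈ Δ1) (hc2 : ∀ a ∈ Δ2, 2 * a % 15 ∈ Δ2) :
    dualK (ZMod 2) (subfieldSubcode (ZMod 2) (schur (Cone Δ1) (Cone Δ2)))
        ≠ schur (dualK (ZMod 2) (subfieldSubcode (ZMod 2) (Cone Δ1)))
            (dualK (ZMod 2) (subfieldSubcode (ZMod 2) (Cone Δ2))) ∧
    schur (dualK (ZMod 2) (subfieldSubcode (ZMod 2) (Cone Δ1)))
        (dualK (ZMod 2) (subfieldSubcode (ZMod 2) (Cone Δ2)))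
      = fieldVectors (ZMod 2) F16 Zpts ∧
    dualK (ZMod 2) (subfieldSubcode (ZMod 2) (schur (Cone Δ1) (Cone Δ2)))
      < fieldVectors (ZMod 2) F16 Zpts := by
  subst hΔ1 hΔ2
  have hR := le_antisymm
    (schur_le_fieldVectors
      (dualK_le_fieldVectors (subfieldSubcode (ZMod 2) (Cone {1, 2, 4, 8})))
      (dualK_le_fieldVectors (subfieldSubcode (ZMod 2) (Cone {0}))))
    (fieldVectors_le_of_single_mem single_mem_schur_dualK)
  have hL := dualK_subfieldSubcode_schur_lt
  exact ⟨by rw [hR]; exact hL.ne, hR, hL⟩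

end
end

section
/- Let m ≥ 2, let s ≥ 0 and r ≥ 0 be integers, and let S = (s_1,…,s_m) be positive integer weights with s_1 ≤ ⋯ ≤ s_m. Let C_1 = WRM_2(s, m, S) be the binary weighted Reed–Muller code and C_2 = RM_2(r, m) the binary Reed–Muller code, where r ≤ max{ v ∈ {0,…,m} : s ≥ ∑_{i=m−v+1}^{m} s_i }. Set a = max{ j ∈ {0,…,m} : 2s ≥ ∑_{i=1}^{j} s_i }. If a + r < m, then (C_1, C_2) is a CSS-T pair, i.e., C_2 ⊆ C_1 and C_2 ⊆ (C_1 ⋆ C_1)^⊥. -/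
attribute [local instance] Classical.propDecidable

noncomputable section

/-- The Reed–Muller code `RM_q(s, m) ⊆ F_q^(q^m)`: the span of the evaluations at
all points of `F_q^m` of the monomials `X^e` with `e ∈ {0,…,q−1}^m` and
`e₁ + ⋯ + e_m ≤ s`. -/
def RM (F : Type) [Field F] [Fintype F] (m s : ℕ) : Submodule F ((Fin m → F) → F) :=
  Submodule.span F
    {v | ∃ e : Fin m → ℕ, (∀ j, e j ≤ Fintype.card F - 1) ∧ (∑ j, e j) ≤ s ∧
      v = fun P => ∏ j, P j ^ e j}

/-- The weighted Reed–Muller code `WRM_q(s, m, S) ⊆ F_q^(q^m)`: the span of the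
evaluations of the monomials `X^e` with `e ∈ {0,…,q−1}^m` and
`s₁e₁ + ⋯ + s_m e_m ≤ s`. -/
def WRM (F : Type) [Field F] [Fintype F] (m s : ℕ) (S : Fin m → ℕ) :
    Submodule F ((Fin m → F) → F) :=
  Submodule.span F
    {v | ∃ e : Fin m → ℕ, (∀ j, e j ≤ Fintype.card F - 1) ∧ (∑ j, S j * e j) ≤ s ∧
      v = fun P => ∏ j, P j ^ e j}

/-- Sum of the last `v` weights, `∑_{i=m−v+1}^{m} s_i`. -/
def lastSum (m : ℕ) (S : Fin m → ℕ) (v : ℕ) : ℕ :=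
  ∑ i ∈ Finset.univ.filter (fun i : Fin m => m - v ≤ (i : ℕ)), S i

/-- Sum of the first `v` weights, `∑_{i=1}^{v} s_i`. -/
def firstSum (m : ℕ) (S : Fin m → ℕ) (v : ℕ) : ℕ :=
  ∑ i ∈ Finset.univ.filter (fun i : Fin m => (i : ℕ) < v), S i

/-- `v_min(s) = max{ v ∈ {0,…,m} : s ≥ ∑_{i=m−v+1}^m s_i }`. -/
def vmin (m : ℕ) (S : Fin m → ℕ) (s : ℕ) : ℕ :=
  Nat.findGreatest (fun v => lastSum m S v ≤ s) m

/-- `v_max(s) = max{ v ∈ {0,…,m} : s ≥ ∑_{i=1}^v s_i }`. -/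
def vmax (m : ℕ) (S : Fin m → ℕ) (s : ℕ) : ℕ :=
  Nat.findGreatest (fun v => firstSum m S v ≤ s) m

open Finset in
/-- An exchange inequality: if `#A ≤ #B` and every weight on `A \ B` is at most every weight
on `B \ A`, then the total weight of `A` is at most that of `B`. -/
theorem sum_le_sum_of_card_le_of_sdiff_le {ι : Type*} (f : ι → ℕ) (A B : Finset ι)
    (hcard : #A ≤ #B) (h : ∀ i ∈ A \ B, ∀ j ∈ B \ A, f i ≤ f j) :
    ∑ i ∈ A, f i ≤ ∑ i ∈ B, f i := by
  have hsdiff : #(A \ B) ≤ #(B \ A) := card_sdiff_le_card_sdiff_iff.mpr hcard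
  rw [← sum_inter_add_sum_sdiff A B, ← sum_inter_add_sum_sdiff B A, inter_comm B A]
  refine Nat.add_le_add_left ?_ _
  calc ∑ i ∈ A \ B, f i ≤ #(A \ B) • (A \ B).sup f :=
        sum_le_card_nsmul _ _ _ fun i hi => le_sup hi
    _ ≤ #(B \ A) • (A \ B).sup f := Nat.mul_le_mul_right _ hsdiff
    _ ≤ ∑ i ∈ B \ A, f i :=
        card_nsmul_le_sum _ _ _ fun j hj => Finset.sup_le fun i hi => h i hi j hj

theorem firstSum_le_sum {m v : ℕ} {S : Fin m → ℕ} (hmono : Monotone S) (T : Finset (Fin m))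
    (hv : v ≤ T.card) : firstSum m S v ≤ ∑ i ∈ T, S i := by
  refine sum_le_sum_of_card_le_of_sdiff_le S _ T ?_ fun i hi j hj => hmono ?_
  · rw [Fin.card_filter_val_lt]
    omega
  · simp only [Finset.mem_sdiff, Finset.mem_filter, Finset.mem_univ, true_and, not_lt] at hi hj
    exact Fin.le_def.mpr (by omega)

theorem sum_le_lastSum {m v : ℕ} {S : Fin m → ℕ} (hmono : Monotone S) (T : Finset (Fin m))
    (hv : T.card ≤ v) : ∑ i ∈ T, S i ≤ lastSum m S v := by
  refine sum_le_sum_of_card_le_of_sdiff_le S T _ ?_ fun i hi j hj => hmono ?_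
  · have hT : T.card ≤ m := by simpa using T.card_le_univ
    have hsplit := Finset.card_filter_add_card_filter_not (s := Finset.univ)
      (fun i : Fin m => (i : ℕ) < m - v)
    simp only [not_lt, Fin.card_filter_val_lt, Finset.card_univ, Fintype.card_fin] at hsplit
    omega
  · simp only [Finset.mem_sdiff, Finset.mem_filter, Finset.mem_univ, true_and, not_le] at hi hj
    exact Fin.le_def.mpr (by omega)

theorem lastSum_vmin_le (m : ℕ) (S : Fin m → ℕ) (s : ℕ) : lastSum m S (vmin m S s) ≤ s := by
  refine Nat.findGreatest_spec (P := fun v => lastSum m S v ≤ s) (Nat.zero_le m) ?_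
  rw [lastSum, Finset.filter_false_of_mem (by simp)]
  simp

theorem card_le_vmax {m s : ℕ} {S : Fin m → ℕ} (hmono : Monotone S) (T : Finset (Fin m))
    (hT : ∑ i ∈ T, S i ≤ s) : T.card ≤ vmax m S s :=
  Nat.le_findGreatest (by simpa using T.card_le_univ) ((firstSum_le_sum hmono T le_rfl).trans hT)

theorem RM_le_WRM {m s r : ℕ} {S : Fin m → ℕ} (hmono : Monotone S) (hr : r ≤ vmin m S s) :
    RM (ZMod 2) m r ≤ WRM (ZMod 2) m s S := by
  refine Submodule.span_mono ?_
  rintro _ ⟨e, he, hsum, rfl⟩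
  refine ⟨e, he, ?_, rfl⟩
  have he' : ∀ j, e j = if e j ≠ 0 then 1 else 0 := by
    intro j
    have := he j
    rw [ZMod.card] at this
    split_ifs <;> omega
  have hcard : (Finset.univ.filter fun j => e j ≠ 0).card = ∑ j, e j := by
    rw [Finset.card_filter]
    exact Finset.sum_congr rfl fun j _ => (he' j).symm
  calc ∑ j, S j * e j = ∑ j ∈ Finset.univ.filter (fun j => e j ≠ 0), S j := by
        rw [Finset.sum_filter]
        refine Finset.sum_congr rfl fun j _ => ?_
        have := he' j
        split_ifs at this ⊢ <;> simp [this]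
    _ ≤ lastSum m S (vmin m S s) := sum_le_lastSum hmono _ (by omega)
    _ ≤ s := lastSum_vmin_le m S s

/-- Over `F_2`, a monomial that misses a variable sums to zero over the whole space. -/
theorem sum_prod_pow_eq_zero {m : ℕ} (e : Fin m → ℕ) (j : Fin m) (hj : e j = 0) :
    ∑ P : Fin m → ZMod 2, ∏ i, P i ^ e i = 0 := by
  have h := Finset.prod_univ_sum (fun _ : Fin m => (Finset.univ : Finset (ZMod 2)))
    (fun i x => x ^ e i)
  rw [Fintype.piFinset_univ] at h
  rw [← h]
  refine Finset.prod_eq_zero (Finset.mem_univ j) ?_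
  simp [hj, ZMod.card, CharTwo.two_eq_zero]

theorem exists_add_add_eq_zero {m s r : ℕ} {S : Fin m → ℕ} (hmono : Monotone S)
    (har : vmax m S (2 * s) + r < m) {e f g : Fin m → ℕ} (he : ∑ j, e j ≤ r)
    (hf : ∑ j, S j * f j ≤ s) (hg : ∑ j, S j * g j ≤ s) : ∃ j, e j + f j + g j = 0 := by
  by_contra! h
  have hT : (Finset.univ.filter fun j => f j + g j ≠ 0).card ≤ vmax m S (2 * s) := by
    refine card_le_vmax hmono _ ?_
    calc ∑ j ∈ Finset.univ.filter (fun j => f j + g j ≠ 0), S j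
        ≤ ∑ j, (S j * f j + S j * g j) := by
          rw [Finset.sum_filter]
          refine Finset.sum_le_sum fun j _ => ?_
          split_ifs with hj
          · rw [← mul_add]
            exact Nat.le_mul_of_pos_right _ (Nat.pos_of_ne_zero hj)
          · exact Nat.zero_le _
      _ ≤ 2 * s := by
          rw [Finset.sum_add_distrib]
          omega
  have hE : (Finset.univ.filter fun j => ¬ (f j + g j ≠ 0)).card ≤ r := by
    refine le_trans ?_ he
    rw [Finset.card_filter]
    refine Finset.sum_le_sum fun j _ => ?_
    have := h j
    split_ifs <;> omega
  have hsplit := Finset.card_filter_add_card_filter_not (s := Finset.univ)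
    (fun j => f j + g j ≠ 0)
  rw [Finset.card_univ, Fintype.card_fin] at hsplit
  omega

theorem RM_le_dualCode_schur_WRM {m s r : ℕ} {S : Fin m → ℕ} (hmono : Monotone S)
    (har : vmax m S (2 * s) + r < m) :
    RM (ZMod 2) m r ≤
      dualCode (ZMod 2) (schur (WRM (ZMod 2) m s S) (WRM (ZMod 2) m s S)) := by
  refine Submodule.span_le.mpr ?_
  rintro _ ⟨e, -, he, rfl⟩ c hc
  induction hc using Submodule.span_induction with
  | zero => simp
  | add x y _ _ hx hy => simp only [Pi.add_apply, mul_add, Finset.sum_add_distrib, hx, hy, add_zero]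
  | smul a x _ hx =>
    simp only [Pi.smul_apply, smul_eq_mul, mul_left_comm _ a, ← Finset.mul_sum, hx, mul_zero]
  | mem w hw =>
    obtain ⟨u, hu, v, hv, rfl⟩ := hw
    induction hu, hv using Submodule.span_induction₂ with
    | zero_left | zero_right => simp
    | add_left x y z _ _ _ hx hy =>
      simp only [Pi.mul_apply, Pi.add_apply, add_mul, mul_add, Finset.sum_add_distrib] at hx hy ⊢
      rw [hx, hy, add_zero]
    | add_right x y z _ _ _ hx hy =>
      simp only [Pi.mul_apply, Pi.add_apply, mul_add, Finset.sum_add_distrib] at hx hy ⊢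
      rw [hx, hy, add_zero]
    | smul_left a x y _ _ h =>
      rw [smul_mul_assoc]
      simp only [Pi.smul_apply, smul_eq_mul, mul_left_comm _ a, ← Finset.mul_sum, h, mul_zero]
    | smul_right a x y _ _ h =>
      rw [mul_smul_comm]
      simp only [Pi.smul_apply, smul_eq_mul, mul_left_comm _ a, ← Finset.mul_sum, h, mul_zero]
    | mem_mem u v hu hv =>
      obtain ⟨f, -, hf, rfl⟩ := hu
      obtain ⟨g, -, hg, rfl⟩ := hv
      obtain ⟨j, hj⟩ := exists_add_add_eq_zero hmono har he hf hg
      simpa only [Pi.mul_apply, pow_add, Finset.prod_mul_distrib, mul_assoc] using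
        sum_prod_pow_eq_zero (fun j => e j + f j + g j) j hj

/-- for `m ≥ 2`, `C₁ = WRM_2(s, m, S)`, `C₂ = RM_2(r, m)` with
`r ≤ v_min(s)` and `a + r < m` where `a = max{ j : 2s ≥ ∑_{i=1}^j s_i }`,
the pair `(C₁, C₂)` is CSS-T: `C₂ ⊆ C₁` and `C₂ ⊆ (C₁ ⋆ C₁)^⊥`. -/
theorem WRM_RM_cssT_pair
    (m s r : ℕ) (hm : 2 ≤ m)
    (S : Fin m → ℕ) (hS : ∀ i, 0 < S i) (hmono : Monotone S)
    (hr : r ≤ vmin m S s)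
    (har : vmax m S (2 * s) + r < m) :
    RM (ZMod 2) m r ≤ WRM (ZMod 2) m s S ∧
    RM (ZMod 2) m r ≤ dualCode (ZMod 2) (schur (WRM (ZMod 2) m s S) (WRM (ZMod 2) m s S)) := by
  exact ⟨RM_le_WRM hmono hr, RM_le_dualCode_schur_WRM hmono har⟩

end
end

section
/- Let q = 2^r be a power of 2, m ≥ 1, N_j > 1 with N_j − 1 dividing q − 1 for j = 1,…,m, and J ⊆ {1,…,m}. Let Δ_1, Δ_2 ⊆ E' := {0,…,N_1−2} × ⋯ × {0,…,N_m−2} be unions of complete cyclotomic sets with respect to F_2. Then the pair of binary subfield subcodes (S(C^J_{Δ_1}), S(C^J_{Δ_2})) is a CSS-T pair if and only if (1) Δ_2 ⊆ Δ_1, and (2) \overline{Δ_1 + Δ_1} ⊆ Δ_2^⊥, where Δ_2^⊥ = E_J \ { \overline{(N_1 − 1 − a_1, …, N_m − 1 − a_m)} : a ∈ Δ_2 }. -/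
attribute [local instance] Classical.propDecidable

open scoped Pointwise

noncomputable section

/-- A pair `(C₁, C₂)` of binary (i.e. `K`-linear, with `K` the binary subfield)
codes is a CSS-T pair if `C₂ ⊆ C₁` and `C₂ ⊆ (C₁ ⋆ C₁)^⊥`. -/
def IsCSSTPair {K F n : Type} [Field K] [Field F] [Algebra K F] [Fintype n]
    (C1 C2 : Submodule K (n → F)) : Prop :=
  C2 ≤ C1 ∧ C2 ≤ dualK K (schur C1 C1)

section RootSums

variable {F : Type} [Field F] [Fintype F]

theorem exists_isPrimitiveRoot_of_dvd_card_sub_one {d : ℕ} (hd : d ∣ Fintype.card F - 1) :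
    ∃ ζ : F, IsPrimitiveRoot ζ d := by
  obtain ⟨g, hg⟩ := IsCyclic.exists_ofOrder_eq_natCard (α := Fˣ)
  rw [Nat.card_eq_fintype_card, Fintype.card_units] at hg
  obtain ⟨e, he⟩ := hd
  have hpos : 0 < Fintype.card F - 1 := Nat.sub_pos_of_lt Fintype.one_lt_card
  have hprim : IsPrimitiveRoot g (Fintype.card F - 1) := hg ▸ IsPrimitiveRoot.orderOf g
  exact ⟨_, IsPrimitiveRoot.coe_units_iff.2 (hprim.pow hpos (he.trans (mul_comm d e)))⟩

/-- The power sums of the `d`-th roots of unity in a finite field whose order is `1` modulo `d`. -/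
theorem sum_pow_of_pow_eq_one {d : ℕ} (hd0 : 0 < d) (hd : d ∣ Fintype.card F - 1) (a : ℕ) :
    ∑ x : F with x ^ d = 1, x ^ a = if d ∣ a then (d : F) else 0 := by
  obtain ⟨ζ, hζ⟩ := exists_isPrimitiveRoot_of_dvd_card_sub_one hd
  split_ifs with h
  · obtain ⟨c, rfl⟩ := h
    have hcard : (Finset.univ.filter fun x : F => x ^ d = 1) =
        Polynomial.nthRootsFinset d (1 : F) := by
      ext x
      simp [Polynomial.mem_nthRootsFinset hd0]
    rw [Finset.sum_congr rfl (g := fun _ => (1 : F)), hcard, Finset.sum_const,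
      hζ.card_nthRootsFinset, nsmul_one]
    intro x hx
    rw [pow_mul, (Finset.mem_filter.1 hx).2, one_pow]
  · have hne : ζ ^ a ≠ 1 := fun h1 => h ((hζ.pow_eq_one_iff_dvd a).1 h1)
    have hζ0 : ζ ≠ 0 := hζ.ne_zero hd0.ne'
    have hinv : ∑ x : F with x ^ d = 1, x ^ a = ζ ^ a * ∑ x : F with x ^ d = 1, x ^ a := by
      rw [Finset.mul_sum]
      refine Finset.sum_equiv (Equiv.mulLeft₀ ζ hζ0).symm ?_ ?_
      · intro x
        simp [mul_pow, inv_pow, hζ.pow_eq_one]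
      · intro x _
        simp [← mul_pow, hζ0]
    by_contra hS
    exact hne (mul_right_cancel₀ hS (by rw [one_mul, ← hinv]))

theorem sum_pow_of_pow_succ_eq_self {d : ℕ} (hd0 : 0 < d) (hd : d ∣ Fintype.card F - 1)
    (a : ℕ) :
    ∑ x : F with x ^ (d + 1) = x, x ^ a = 0 ^ a + if d ∣ a then (d : F) else 0 := by
  have hset : (Finset.univ.filter fun x : F => x ^ (d + 1) = x) =
      insert 0 (Finset.univ.filter fun x : F => x ^ d = 1) := by
    ext x
    by_cases hx : x = 0
    · simp [hx]
    · simp [hx, pow_succ]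
  rw [hset, Finset.sum_insert (by simp [hd0.ne']), sum_pow_of_pow_eq_one hd0 hd]

end RootSums

section Descent

variable {K F ι : Type} [Field K] [Fintype K] [Field F] [Fintype F] [Algebra K F]

/-- Galois descent: a code stable under the coordinatewise Frobenius of `K` is spanned by its
subfield subcode over `K`. -/
theorem span_subfieldSubcode_eq (C : Submodule F (ι → F))
    (hC : ∀ v ∈ C, v ^ Fintype.card K ∈ C) :
    Submodule.span F (subfieldSubcode K C : Set (ι → F)) = C := by
  refine le_antisymm (Submodule.span_le.2 fun v hv => hv.1) fun v hv => ?_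
  have hpow : ∀ i : ℕ, ∀ w ∈ C, w ^ Fintype.card K ^ i ∈ C := by
    intro i
    induction i with
    | zero => simp
    | succ i ih => exact fun w hw => by rw [pow_succ, pow_mul]; exact hC _ (ih w hw)
  let b := Module.finBasis K F
  let b' := (Algebra.traceForm K F).dualBasis (traceForm_nondegenerate K F) b
  have htr : ∀ i, (fun p => algebraMap K F (Algebra.trace K F (v p * b i))) ∈
      subfieldSubcode K C := by
    refine fun i => ⟨?_, fun p => ⟨_, rfl⟩⟩
    have : (fun p => algebraMap K F (Algebra.trace K F (v p * b i))) =
        ∑ k ∈ Finset.range (Module.finrank K F), (b i • v) ^ Fintype.card K ^ k := by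
      ext p
      simp [FiniteField.algebraMap_trace_eq_sum_pow, mul_comm]
    rw [this]
    exact C.sum_mem fun k _ => hpow k _ (C.smul_mem _ hv)
  have hv' : v = ∑ i, b' i • fun p => algebraMap K F (Algebra.trace K F (v p * b i)) := by
    ext p
    conv_lhs => rw [← b'.sum_repr (v p)]
    simp [b', LinearMap.BilinForm.dualBasis_repr_apply, Algebra.traceForm_apply,
      Algebra.smul_def, mul_comm]
  rw [hv']
  exact Submodule.sum_mem _ fun i _ => Submodule.smul_mem _ _ (Submodule.subset_span (htr i))

end Descent

theorem sum_mul_mul_eq_zero_of_mem_span {F ι : Type} [Field F] [Fintype ι]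
    {S T U : Set (ι → F)} (h : ∀ u ∈ S, ∀ v ∈ T, ∀ w ∈ U, ∑ i, w i * (u i * v i) = 0)
    {u v w : ι → F} (hu : u ∈ Submodule.span F S) (hv : v ∈ Submodule.span F T)
    (hw : w ∈ Submodule.span F U) : ∑ i, w i * (u i * v i) = 0 := by
  induction hu using Submodule.span_induction with
  | zero => simp
  | add x y _ _ hx hy => simp [add_mul, mul_add, Finset.sum_add_distrib, hx, hy]
  | smul c x _ hx => simp [mul_assoc, mul_left_comm _ c, ← Finset.mul_sum, hx]
  | mem u hu =>
    induction hv using Submodule.span_induction with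
    | zero => simp
    | add x y _ _ hx hy => simp [mul_add, Finset.sum_add_distrib, hx, hy]
    | smul c x _ hx => simp [mul_left_comm _ c, ← Finset.mul_sum, hx]
    | mem v hv =>
      induction hw using Submodule.span_induction with
      | zero => simp
      | add x y _ _ hx hy => simp [add_mul, Finset.sum_add_distrib, hx, hy]
      | smul c x _ hx => simp [mul_assoc, ← Finset.mul_sum, hx]
      | mem w hw => exact h u hu v hv w hw

section Codes

variable {F : Type} [Field F] {m : ℕ} {N : Fin m → ℕ} {J : Set (Fin m)}

theorem evJ_add (a b : Fin m → ℕ) : evJ F m N J (a + b) = evJ F m N J a * evJ F m N J b := by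
  ext P
  simp [evJ, pow_add, Finset.prod_mul_distrib]

theorem evJ_barJ (hN : ∀ j, 1 < N j) (a : Fin m → ℕ) :
    evJ F m N J (barJ m N J a) = evJ F m N J a := by
  ext P
  refine Finset.prod_congr rfl fun j _ => ?_
  have hP := P.2 j
  unfold barJ
  split_ifs at hP ⊢ with hj ha
  · exact (pow_eq_pow_mod _ hP).symm
  · rw [ha]
  · by_cases hx : (P : Fin m → F) j = 0
    · simp [hx, ha]
    · have h1 : (P : Fin m → F) j ^ (N j - 1) = 1 := by
        refine mul_right_cancel₀ hx ?_
        rw [← pow_succ, Nat.sub_add_cancel (hN j).le, hP, one_mul]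
      rw [pow_succ, ← pow_eq_pow_mod _ h1, ← pow_succ, Nat.sub_add_cancel (by omega)]

theorem barJ_mem_EJ (hN : ∀ j, 1 < N j) (a : Fin m → ℕ) : barJ m N J a ∈ EJ m N J := by
  intro j
  have := hN j
  have h1 := Nat.mod_lt (a j) (show N j - 1 > 0 by omega)
  have h2 := Nat.mod_lt (a j - 1) (show N j - 1 > 0 by omega)
  unfold barJ
  split_ifs <;> omega

theorem pow_two_mem_CJ [CharP F 2] (hN : ∀ j, 1 < N j) {Δ : Set (Fin m → ℕ)}
    (hΔ : ∀ a ∈ Δ, barJ m N J (fun j => 2 * a j) ∈ Δ) {v : ZJ F m N J → F}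
    (hv : v ∈ CJ F m N J Δ) : v ^ 2 ∈ CJ F m N J Δ := by
  unfold CJ at hv
  induction hv using Submodule.span_induction with
  | zero => simp
  | add x y _ _ hx hy =>
    have : (x + y) ^ 2 = x ^ 2 + y ^ 2 := by
      ext p
      simp [CharTwo.add_sq]
    rw [this]
    exact Submodule.add_mem _ hx hy
  | smul c x _ hx =>
    rw [smul_pow]
    exact Submodule.smul_mem _ _ hx
  | mem x hx =>
    obtain ⟨a, ha, rfl⟩ := hx
    refine Submodule.subset_span ⟨_, hΔ a ha, ?_⟩
    rw [evJ_barJ hN, sq, ← evJ_add]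
    congr 1
    ext j
    simp [two_mul]

theorem sum_evJ_ne_zero_iff [Fintype F] [CharP F 2] (hN : ∀ j, 1 < N j)
    (hdiv : ∀ j, (N j - 1) ∣ (Fintype.card F - 1)) (hodd : Odd (Fintype.card F - 1))
    (a : Fin m → ℕ) :
    ∑ P, evJ F m N J a P ≠ 0 ↔ ∀ j, N j - 1 ∣ a j ∧ (j ∉ J → a j ≠ 0) := by
  let t : Fin m → Finset F := fun j =>
    Finset.univ.filter fun x => if j ∈ J then x ^ (N j - 1) = 1 else x ^ N j = x
  have hsum : ∑ P, evJ F m N J a P = ∏ j, ∑ x ∈ t j, x ^ a j := by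
    rw [Finset.prod_univ_sum]
    refine (Finset.sum_subtype (Fintype.piFinset t) (p := (· ∈ ZJ F m N J)) ?_
      fun P : Fin m → F => ∏ j, P j ^ a j).symm
    simp [t, ZJ]
  rw [hsum, Finset.prod_ne_zero_iff]
  refine ⟨fun h j => ?_, fun h j _ => ?_⟩
  all_goals
    have hd0 : 0 < N j - 1 := Nat.sub_pos_of_lt (hN j)
    have hd1 : ((N j - 1 : ℕ) : F) = 1 := by
      obtain ⟨k, hk⟩ := hodd.of_dvd_nat (hdiv j)
      rw [hk]
      simp [CharTwo.two_eq_zero]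
    have hJ : j ∈ J → ∑ x ∈ t j, x ^ a j = if N j - 1 ∣ a j then 1 else 0 := by
      intro hj
      simp only [t, hj, if_true]
      rw [sum_pow_of_pow_eq_one hd0 (hdiv j), hd1]
    have hJ' : j ∉ J → ∑ x ∈ t j, x ^ a j = 0 ^ a j + if N j - 1 ∣ a j then 1 else 0 := by
      intro hj
      have := sum_pow_of_pow_succ_eq_self hd0 (hdiv j) (a j)
      rw [Nat.sub_add_cancel (hN j).le, hd1] at this
      simpa only [t, hj, if_false] using this
  · have hj := h j (Finset.mem_univ j)
    by_cases hjJ : j ∈ J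
    · rw [hJ hjJ] at hj
      exact ⟨by simpa using hj, fun h' => absurd hjJ h'⟩
    · rw [hJ' hjJ] at hj
      have ha : a j ≠ 0 := by
        intro ha
        simp [ha, CharTwo.add_self_eq_zero] at hj
      rw [zero_pow ha] at hj
      exact ⟨by simpa using hj, fun _ => ha⟩
  · by_cases hjJ : j ∈ J
    · rw [hJ hjJ]
      simp [(h j).1]
    · rw [hJ' hjJ]
      simp [(h j).1, (h j).2 hjJ]

theorem barJ_eq_barJ_sub_iff (hN : ∀ j, 1 < N j) {b : Fin m → ℕ} (hb : ∀ j, b j ≤ N j - 2)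
    (s : Fin m → ℕ) :
    barJ m N J s = barJ m N J (fun j => N j - 1 - b j) ↔
      ∀ j, N j - 1 ∣ (b + s) j ∧ (j ∉ J → (b + s) j ≠ 0) := by
  rw [funext_iff]
  refine forall_congr' fun j => ?_
  have hNj := hN j
  have hbj := hb j
  obtain ⟨d, hd⟩ : ∃ d, N j - 1 = d := ⟨_, rfl⟩
  have hd0 : 0 < d := by omega
  have hbd : b j < d := by omega
  have key : s j ≡ d - b j [MOD d] ↔ d ∣ b j + s j := by
    rw [← Nat.modEq_zero_iff_dvd]
    constructor
    · intro h
      have h2 := h.add_left (b j)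
      rw [Nat.add_sub_cancel' hbd.le] at h2
      exact h2.trans (by simp [Nat.ModEq])
    · intro h
      refine Nat.ModEq.add_left_cancel' (b j) (h.trans ?_)
      rw [Nat.add_sub_cancel' hbd.le]
      simp [Nat.ModEq]
  simp only [barJ, hd, Pi.add_apply]
  by_cases hj : j ∈ J
  · simpa [hj, Nat.ModEq] using key
  · have hne : d - b j ≠ 0 := by omega
    rw [if_neg hj, if_neg hj, if_neg hne]
    by_cases hs : s j = 0
    · rw [if_pos hs, hs]
      refine ⟨fun h => by omega, fun ⟨h1, h2⟩ => ?_⟩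
      have := Nat.le_of_dvd (Nat.pos_of_ne_zero (h2 hj)) h1
      omega
    · rw [if_neg hs, Nat.add_right_cancel_iff, ← key]
      have hmod : (s j - 1) % d = (d - b j - 1) % d ↔ s j ≡ d - b j [MOD d] := by
        constructor
        · intro h
          have := Nat.ModEq.add_right 1 h
          rwa [Nat.sub_add_cancel (by omega), Nat.sub_add_cancel (by omega)] at this
        · intro h
          refine Nat.ModEq.add_right_cancel' 1 ?_
          rwa [Nat.sub_add_cancel (by omega), Nat.sub_add_cancel (by omega)]
      rw [hmod]
      exact ⟨fun h => ⟨h, fun _ => by omega⟩, fun h => h.1⟩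

theorem evJ_mem_CJ_iff [Fintype F] [CharP F 2] (hN : ∀ j, 1 < N j)
    (hdiv : ∀ j, (N j - 1) ∣ (Fintype.card F - 1)) (hodd : Odd (Fintype.card F - 1))
    {Δ : Set (Fin m → ℕ)} (hΔ : ∀ a ∈ Δ, ∀ j, a j ≤ N j - 2) {b : Fin m → ℕ}
    (hb : ∀ j, b j ≤ N j - 2) : evJ F m N J b ∈ CJ F m N J Δ ↔ b ∈ Δ := by
  refine ⟨fun h => ?_, fun h => Submodule.subset_span ⟨b, h, rfl⟩⟩
  by_contra hbΔ
  let c : Fin m → ℕ := fun j => N j - 1 - b j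
  have hzero : ∀ v ∈ CJ F m N J Δ, ∑ P, v P * evJ F m N J c P = 0 := by
    intro v hv
    unfold CJ at hv
    induction hv using Submodule.span_induction with
    | zero => simp
    | add x y _ _ hx hy => simp [add_mul, Finset.sum_add_distrib, hx, hy]
    | smul r x _ hx => simp [mul_assoc, ← Finset.mul_sum, hx]
    | mem x hx =>
      obtain ⟨a, ha, rfl⟩ := hx
      by_contra hne
      simp_rw [← Pi.mul_apply, ← evJ_add] at hne
      have h0 := (sum_evJ_ne_zero_iff hN hdiv hodd _).1 hne
      refine hbΔ ((funext fun j => ?_ : b = a) ▸ ha)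
      obtain ⟨k, hk⟩ := (h0 j).1
      simp only [Pi.add_apply, c] at hk
      have h1 := hΔ a ha j
      have h2 := hb j
      have h3 := hN j
      obtain ⟨d, hd⟩ : ∃ d, N j - 1 = d := ⟨_, rfl⟩
      rw [hd] at hk
      have hk1 : k = 1 := by
        have hk0 : 0 < k := Nat.pos_of_ne_zero fun h => by
          rw [h] at hk
          omega
        have hk2 : k < 2 := by
          by_contra hk2
          have := Nat.mul_le_mul_left d (not_lt.1 hk2)
          omega
        omega
      rw [hk1] at hk
      omega
  have h0 := hzero _ h
  simp_rw [← Pi.mul_apply, ← evJ_add] at h0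
  refine (sum_evJ_ne_zero_iff hN hdiv hodd _).2 (fun j => ?_) h0
  have h2 := hb j
  have h3 := hN j
  have : (b + c) j = N j - 1 := by
    simp only [Pi.add_apply, c]
    omega
  rw [this]
  exact ⟨dvd_rfl, fun _ => by omega⟩

theorem sum_evJ_mul_evJ_mul_evJ_eq_zero_iff [Fintype F] [CharP F 2] (hN : ∀ j, 1 < N j)
    (hdiv : ∀ j, (N j - 1) ∣ (Fintype.card F - 1)) (hodd : Odd (Fintype.card F - 1))
    {b : Fin m → ℕ} (hb : ∀ j, b j ≤ N j - 2) (a a' : Fin m → ℕ) :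
    ∑ P, evJ F m N J b P * (evJ F m N J a P * evJ F m N J a' P) = 0 ↔
      barJ m N J (a + a') ≠ barJ m N J (fun j => N j - 1 - b j) := by
  simp_rw [← Pi.mul_apply, ← evJ_add]
  rw [ne_eq, barJ_eq_barJ_sub_iff hN hb, ← sum_evJ_ne_zero_iff (F := F) hN hdiv hodd, not_not]

end Codes

/-- with `q = 2^r`, `Δ₁, Δ₂ ⊆ E' = ∏_j {0,…,N_j − 2}` unions of complete
cyclotomic sets with respect to `F₂`, the pair of binary subfield subcodes
`(S(C^J_{Δ₁}), S(C^J_{Δ₂}))` is CSS-T iff `Δ₂ ⊆ Δ₁` and `bar (Δ₁ + Δ₁) ⊆ Δ₂^⊥`. -/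
theorem cssT_pair_iff
    {F K : Type} [Field F] [Fintype F] [Field K] [Fintype K] [Algebra K F]
    (r : ℕ) (hr : 1 ≤ r) (hF : Fintype.card F = 2 ^ r) (hK : Fintype.card K = 2)
    (m : ℕ) (hm : 1 ≤ m)
    (N : Fin m → ℕ) (hN : ∀ j, 1 < N j)
    (hdiv : ∀ j, (N j - 1) ∣ (Fintype.card F - 1))
    (J : Set (Fin m)) (Δ1 Δ2 : Set (Fin m → ℕ))
    (hΔ1 : Δ1 ⊆ {a | ∀ j, a j ≤ N j - 2})
    (hΔ2 : Δ2 ⊆ {a | ∀ j, a j ≤ N j - 2})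
    (hc1 : ∀ a ∈ Δ1, barJ m N J (fun j => 2 * a j) ∈ Δ1)
    (hc2 : ∀ a ∈ Δ2, barJ m N J (fun j => 2 * a j) ∈ Δ2) :
    IsCSSTPair (subfieldSubcode K (CJ F m N J Δ1)) (subfieldSubcode K (CJ F m N J Δ2)) ↔
      (Δ2 ⊆ Δ1 ∧
        barJ m N J '' (Δ1 + Δ1) ⊆
          EJ m N J \ ((fun a => barJ m N J (fun j => N j - 1 - a j)) '' Δ2)) := by
  have : CharP K 2 := charP_of_card_eq_prime hK
  have : CharP F 2 := charP_of_injective_algebraMap (algebraMap K F).injective 2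
  have hodd : Odd (Fintype.card F - 1) := by
    rw [hF]
    exact Nat.Even.sub_odd Nat.one_le_two_pow ((Nat.even_pow.2 ⟨even_two, by omega⟩)) odd_one
  have hspan1 := span_subfieldSubcode_eq (K := K) (CJ F m N J Δ1)
    fun v hv => hK ▸ pow_two_mem_CJ hN hc1 hv
  have hspan2 := span_subfieldSubcode_eq (K := K) (CJ F m N J Δ2)
    fun v hv => hK ▸ pow_two_mem_CJ hN hc2 hv
  constructor
  · rintro ⟨hle, hdual⟩
    constructor
    · intro b hb
      rw [← evJ_mem_CJ_iff (F := F) (J := J) hN hdiv hodd hΔ1 (hΔ2 hb), ← hspan1]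
      refine Submodule.span_mono hle ?_
      rw [hspan2]
      exact Submodule.subset_span ⟨b, hb, rfl⟩
    · rintro _ ⟨_, ⟨a, ha, a', ha', rfl⟩, rfl⟩
      refine ⟨barJ_mem_EJ hN _, ?_⟩
      rintro ⟨b, hb, heq⟩
      refine (sum_evJ_mul_evJ_mul_evJ_eq_zero_iff (F := F) hN hdiv hodd (hΔ2 hb) a a').1 ?_
        heq.symm
      refine sum_mul_mul_eq_zero_of_mem_span
        (fun u hu v hv w hw => (hdual hw).2 _ (Submodule.subset_span ⟨u, hu, v, hv, rfl⟩))
        (hspan1.ge (Submodule.subset_span ⟨a, ha, rfl⟩))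
        (hspan1.ge (Submodule.subset_span ⟨a', ha', rfl⟩))
        (hspan2.ge (Submodule.subset_span ⟨b, hb, rfl⟩))
  · rintro ⟨hsub, hbar⟩
    refine ⟨fun v hv => ⟨Submodule.span_mono (Set.image_mono hsub) hv.1, hv.2⟩,
      fun w hw => ⟨hw.2, fun c hc => ?_⟩⟩
    unfold schur at hc
    induction hc using Submodule.span_induction with
    | zero => simp
    | add x y _ _ hx hy => simp [mul_add, Finset.sum_add_distrib, hx, hy]
    | smul k x _ hx => simp [Algebra.smul_def, mul_left_comm _ (algebraMap K F k),
        ← Finset.mul_sum, hx]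
    | mem x hx =>
      obtain ⟨u, hu, v, hv, rfl⟩ := hx
      refine sum_mul_mul_eq_zero_of_mem_span ?_ hu.1 hv.1 hw.1
      rintro _ ⟨a, ha, rfl⟩ _ ⟨a', ha', rfl⟩ _ ⟨b, hb, rfl⟩
      rw [sum_evJ_mul_evJ_mul_evJ_eq_zero_iff hN hdiv hodd (hΔ2 hb)]
      exact fun heq => (hbar ⟨_, ⟨a, ha, a', ha', rfl⟩, rfl⟩).2 ⟨b, hb, heq.symm⟩

end
end

section
/- Let q be a power of the prime p, m ≥ 1, N_j > 1 with N_j − 1 dividing q − 1 for j = 1,…,m, and J ⊆ {1,…,m}. For a, b ∈ E_J, the Euclidean inner product ev_J(X^a) · ev_J(X^b) = ∑_{P∈Z} P^{a+b} is nonzero if and only if both of the following hold: (i) for every j ∈ J, a_j + b_j ≡ 0 (mod N_j − 1); and (ii) for every j ∉ J, either a_j + b_j > 0 and a_j + b_j ≡ 0 (mod N_j − 1), or a_j = b_j = 0 and p does not divide N_j. -/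
attribute [local instance] Classical.propDecidable

open scoped Pointwise

noncomputable section

/-- In a finite field of order `q`, every divisor `d` of `q - 1` is the order of a primitive
root of unity. -/
theorem FiniteField.exists_isPrimitiveRoot (F : Type) [Field F] [Fintype F] {d : ℕ}
    (hd : d ∣ Fintype.card F - 1) : ∃ ζ : F, IsPrimitiveRoot ζ d := by
  obtain ⟨g, hg⟩ := IsCyclic.exists_generator (α := Fˣ)
  have hord : orderOf g = Fintype.card F - 1 := by
    rw [orderOf_eq_card_of_forall_mem_zpowers hg, Nat.card_eq_fintype_card, Fintype.card_units]
  have hq : 0 < Fintype.card F - 1 := Nat.sub_pos_of_lt Fintype.one_lt_card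
  obtain ⟨k, hk⟩ := hd
  refine ⟨(g : F) ^ k, ?_⟩
  have hprim : IsPrimitiveRoot (g : F) (Fintype.card F - 1) := by
    rw [IsPrimitiveRoot.coe_units_iff, ← hord]
    exact IsPrimitiveRoot.orderOf g
  exact hprim.pow hq (by rw [hk, mul_comm])

theorem FiniteField.natCast_ne_zero_of_dvd (F : Type) [Field F] [Fintype F] {d : ℕ}
    (hd : d ∣ Fintype.card F - 1) : (d : F) ≠ 0 := by
  obtain ⟨k, hk⟩ := hd
  intro h
  have h1 : ((Fintype.card F - 1 : ℕ) : F) = 0 := by rw [hk, Nat.cast_mul, h, zero_mul]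
  rw [Nat.cast_sub Fintype.card_pos, Nat.cast_card_eq_zero] at h1
  simp at h1

theorem card_filter_pow_eq_one {F : Type} [Field F] [Fintype F] {d : ℕ} (hd0 : 0 < d)
    (hd : d ∣ Fintype.card F - 1) :
    (Finset.univ.filter fun x : F => x ^ d = 1).card = d := by
  obtain ⟨ζ, hζ⟩ := FiniteField.exists_isPrimitiveRoot F hd
  refine (congrArg Finset.card ?_).trans hζ.card_nthRootsFinset
  ext x
  simp [Polynomial.mem_nthRootsFinset hd0]

theorem sum_pow_rootsOfUnity_ne_zero_iff {F : Type} [Field F] [Fintype F] {d : ℕ} (hd0 : 0 < d)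
    (hd : d ∣ Fintype.card F - 1) (c : ℕ) :
    (∑ x : F with x ^ d = 1, x ^ c) ≠ 0 ↔ d ∣ c := by
  constructor
  · obtain ⟨ζ, hζ⟩ := FiniteField.exists_isPrimitiveRoot F hd
    intro hsum
    rw [← hζ.pow_eq_one_iff_dvd]
    have hζ0 : ζ ≠ 0 := hζ.ne_zero hd0.ne'
    have hshift : ∑ x : F with x ^ d = 1, (ζ * x) ^ c = ∑ x : F with x ^ d = 1, x ^ c :=
      Finset.sum_equiv (Equiv.mulLeft₀ ζ hζ0) (by simp [mul_pow, hζ.pow_eq_one]) (by simp)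
    simp only [mul_pow, ← Finset.mul_sum] at hshift
    exact (mul_eq_right₀ hsum).1 hshift
  · rintro ⟨k, rfl⟩
    have hone : ∀ x ∈ Finset.univ.filter (fun x : F => x ^ d = 1), x ^ (d * k) = 1 := by
      intro x hx
      rw [pow_mul, (Finset.mem_filter.1 hx).2, one_pow]
    rw [Finset.sum_congr rfl hone, Finset.sum_const, card_filter_pow_eq_one hd0 hd, nsmul_one]
    exact FiniteField.natCast_ne_zero_of_dvd F hd

theorem sum_pow_filter_pow_eq_self {F : Type} [Field F] [Fintype F] {n : ℕ} (hn : 1 < n)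
    (c : ℕ) :
    ∑ x : F with x ^ n = x, x ^ c = 0 ^ c + ∑ x : F with x ^ (n - 1) = 1, x ^ c := by
  have hset : (Finset.univ.filter fun x : F => x ^ n = x) =
      insert 0 (Finset.univ.filter fun x : F => x ^ (n - 1) = 1) := by
    ext x
    obtain ⟨k, rfl⟩ : ∃ k, n = k + 1 := ⟨n - 1, by omega⟩
    simp [pow_succ, mul_left_eq_self₀, or_comm]
  rw [hset, Finset.sum_insert (by simp [zero_pow (Nat.sub_ne_zero_of_lt hn)])]

theorem sum_pow_filter_pow_eq_self_ne_zero_iff {F : Type} [Field F] [Fintype F] (p : ℕ)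
    [CharP F p] {n : ℕ} (hn : 1 < n) (hd : n - 1 ∣ Fintype.card F - 1) (c : ℕ) :
    (∑ x : F with x ^ n = x, x ^ c) ≠ 0 ↔ (0 < c ∧ n - 1 ∣ c) ∨ (c = 0 ∧ ¬ p ∣ n) := by
  have hn0 : 0 < n - 1 := Nat.sub_pos_of_lt hn
  rw [sum_pow_filter_pow_eq_self hn]
  rcases Nat.eq_zero_or_pos c with rfl | hc
  · simp only [pow_zero, Finset.sum_const, card_filter_pow_eq_one hn0 hd, nsmul_one]
    rw [← Nat.cast_one, ← Nat.cast_add, Nat.add_sub_cancel' hn.le, Ne, CharP.cast_eq_zero_iff F p]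
    simp
  · rw [zero_pow hc.ne', zero_add, sum_pow_rootsOfUnity_ne_zero_iff hn0 hd]
    simp [hc, hc.ne']

theorem sum_evJ_mul_evJ_eq_prod {F : Type} [Field F] [Fintype F] (m : ℕ) (N : Fin m → ℕ)
    (J : Set (Fin m)) (a b : Fin m → ℕ) :
    ∑ P : ZJ F m N J, evJ F m N J a P * evJ F m N J b P =
      ∏ j, ∑ x : F with (if j ∈ J then x ^ (N j - 1) = 1 else x ^ N j = x), x ^ (a j + b j) := by
  rw [Finset.prod_univ_sum]
  rw [Finset.sum_subtype (p := (· ∈ ZJ F m N J)) _ (fun P => by simp [ZJ])]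
  refine Finset.sum_congr rfl fun P _ => ?_
  simp only [evJ, ← Finset.prod_mul_distrib, pow_add]

/-- the Euclidean inner product `ev_J(X^a) · ev_J(X^b) = ∑_{P∈Z} P^{a+b}`
is nonzero iff (i) for every `j ∈ J`, `N_j - 1 ∣ a_j + b_j`, and (ii) for every
`j ∉ J`, either `a_j + b_j > 0` and `N_j - 1 ∣ a_j + b_j`, or `a_j = b_j = 0` and
`p ∤ N_j`. -/
theorem evJ_inner_ne_zero_iff
    {F : Type} [Field F] [Fintype F] (p : ℕ) [Fact p.Prime] [CharP F p]
    (m : ℕ) (hm : 1 ≤ m)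
    (N : Fin m → ℕ) (hN : ∀ j, 1 < N j)
    (hdiv : ∀ j, (N j - 1) ∣ (Fintype.card F - 1))
    (J : Set (Fin m)) (a b : Fin m → ℕ)
    (ha : a ∈ EJ m N J) (hb : b ∈ EJ m N J) :
    (∑ P : ZJ F m N J, evJ F m N J a P * evJ F m N J b P) ≠ 0 ↔
      ((∀ j ∈ J, (N j - 1) ∣ (a j + b j)) ∧
       (∀ j, j ∉ J →
          (0 < a j + b j ∧ (N j - 1) ∣ (a j + b j)) ∨
          (a j = 0 ∧ b j = 0 ∧ ¬ (p ∣ N j)))) := by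
  rw [sum_evJ_mul_evJ_eq_prod, Finset.prod_ne_zero_iff, ← forall_and]
  simp only [Finset.mem_univ, true_implies]
  refine ⟨fun h j => ⟨fun hj => ?_, fun hj => ?_⟩, fun h j => ?_⟩
  · simpa only [if_pos hj, sum_pow_rootsOfUnity_ne_zero_iff (Nat.sub_pos_of_lt (hN j)) (hdiv j)]
      using h j
  · simpa only [if_neg hj, sum_pow_filter_pow_eq_self_ne_zero_iff p (hN j) (hdiv j),
      Nat.add_eq_zero_iff, and_assoc] using h j
  · by_cases hj : j ∈ J
    · simpa only [if_pos hj, sum_pow_rootsOfUnity_ne_zero_iff (Nat.sub_pos_of_lt (hN j)) (hdiv j)]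
        using (h j).1 hj
    · simpa only [if_neg hj, sum_pow_filter_pow_eq_self_ne_zero_iff p (hN j) (hdiv j),
        Nat.add_eq_zero_iff, and_assoc] using (h j).2 hj

end
end

section
/- Let C_{Δ,Z} be a decreasing monomial–Cartesian code where Z = Z_1 × ⋯ × Z_m is an additive subgroup of (F_q^m, +). Then for any two points P, Q ∈ Z, the map π : Z → Z, π(z) = z − P + Q, is a bijection of Z with π(P) = Q, and the induced permutation of the coordinates of F_q^Z maps C_{Δ,Z} onto itself. Consequently, the automorphism group Aut(C_{Δ,Z}) acts transitively on the coordinates, i.e., C_{Δ,Z} is transitive. -/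
noncomputable section

/-- The linear map on `ι → F` induced by a coordinate permutation `σ`,
sending a vector `v` to the permuted vector `v ∘ σ`. -/
def permLM (F : Type) [Field F] {ι : Type} (σ : Equiv.Perm ι) :
    (ι → F) →ₗ[F] (ι → F) where
  toFun v := fun i => v (σ i)
  map_add' := by intro u v; rfl
  map_smul' := by intro c v; rfl

/-- The span of the monomial evaluations with exponents in a divisor-closed set is mapped into
itself by every coordinate permutation that acts as a translation. -/
theorem map_permLM_span_monomials_le {F : Type} [Field F] {m : ℕ} {Δ : Set (Fin m → ℕ)}
    (hdec : ∀ a ∈ Δ, ∀ b : Fin m → ℕ, (∀ j, b j ≤ a j) → b ∈ Δ)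
    {Z : Set (Fin m → F)} (t : Fin m → F) (σ : Equiv.Perm Z)
    (hσ : ∀ z : Z, (σ z : Fin m → F) = z + t) :
    Submodule.map (permLM F σ) (Submodule.span F
      ((fun a => fun P : Z => ∏ j, (P : Fin m → F) j ^ a j) '' Δ)) ≤
    Submodule.span F ((fun a => fun P : Z => ∏ j, (P : Fin m → F) j ^ a j) '' Δ) := by
  rw [Submodule.map_span_le]
  rintro _ ⟨a, ha, rfl⟩
  have expand : permLM F σ (fun P : Z => ∏ j, (P : Fin m → F) j ^ a j) =
      ∑ b ∈ Fintype.piFinset fun j => Finset.range (a j + 1),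
        (∏ j, t j ^ (a j - b j) * ((a j).choose (b j) : F)) •
          fun P : Z => ∏ j, (P : Fin m → F) j ^ b j := by
    funext z
    change ∏ j, (σ z : Fin m → F) j ^ a j = _
    simp only [hσ, Pi.add_apply, add_pow, Finset.prod_univ_sum, Finset.sum_apply, Pi.smul_apply,
      smul_eq_mul, ← Finset.prod_mul_distrib]
    exact Finset.sum_congr rfl fun b _ => Finset.prod_congr rfl fun j _ => by ring
  rw [expand]
  refine Submodule.sum_mem _ fun b hb => Submodule.smul_mem _ _ (Submodule.subset_span ⟨b, ?_, rfl⟩)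
  exact hdec a ha b fun j =>
    Nat.lt_succ_iff.mp (Finset.mem_range.mp (Fintype.mem_piFinset.mp hb j))

/-- a decreasing monomial–Cartesian code `C_{Δ,Z}` with `Z`
an additive subgroup of `F_q^m` is transitive: for any `P, Q ∈ Z` the map
`π(z) = z − P + Q` is a bijection of `Z` sending `P` to `Q` whose induced
coordinate permutation maps `C_{Δ,Z}` onto itself. -/
theorem decreasing_monomial_cartesian_transitive
    {F : Type} [Field F] [Fintype F] (m : ℕ) (hm : 1 ≤ m)
    (Zj : Fin m → Set F) (hZj : ∀ j, 2 ≤ (Zj j).ncard)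
    (Δ : Set (Fin m → ℕ))
    (hΔE : Δ ⊆ {a | ∀ j, a j ≤ (Zj j).ncard - 1})
    (hdec : ∀ a ∈ Δ, ∀ b : Fin m → ℕ, (∀ j, b j ≤ a j) → b ∈ Δ)
    (Z : Set (Fin m → F)) (hZ : Z = {P | ∀ j, P j ∈ Zj j})
    (hgroup : ∃ H : AddSubgroup (Fin m → F), (H : Set (Fin m → F)) = Z)
    (C : Submodule F (Z → F))
    (hC : C = Submodule.span F
      ((fun a => fun P : Z => ∏ j, (P : Fin m → F) j ^ a j) '' Δ)) :
    ∀ P Q : Z, ∃ σ : Equiv.Perm Z,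
      (∀ z : Z, (σ z : Fin m → F) = (z : Fin m → F) - (P : Fin m → F) + (Q : Fin m → F)) ∧
      σ P = Q ∧
      Submodule.map (permLM F σ) C = C := by
  obtain ⟨H, rfl⟩ := hgroup
  intro P Q
  let σ : Equiv.Perm (H : Set (Fin m → F)) :=
    { toFun := fun z => ⟨z - P + Q, H.add_mem (H.sub_mem z.2 P.2) Q.2⟩
      invFun := fun z => ⟨z - Q + P, H.add_mem (H.sub_mem z.2 Q.2) P.2⟩
      left_inv := fun z => Subtype.ext (by simp)
      right_inv := fun z => Subtype.ext (by simp) }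
  refine ⟨σ, fun z => rfl, Subtype.ext (by simp [σ]), ?_⟩
  subst hC
  refine le_antisymm (map_permLM_span_monomials_le hdec (Q.1 - P.1) σ fun z => ?_) ?_
  · change (z : Fin m → F) - P + Q = _
    abel
  · intro v hv
    refine ⟨permLM F σ.symm v, map_permLM_span_monomials_le hdec (P.1 - Q.1) σ.symm
      (fun z => ?_) ⟨v, hv, rfl⟩, ?_⟩
    · change (z : Fin m → F) - Q + P = _
      abel
    · funext z
      exact congrArg v (σ.symm_apply_apply z)

end
end

section
/- Let q be a prime power with q > 4 and r ≥ 1, and work with the ambient field F_{q^r} and subfield F_q. Let m = 2, J = ∅, and N_1, N_2 > 1 with N_1 − 1 dividing q^r − 1 and N_2 − 1 dividing q − 1, so n_J = N_1 N_2. Let 0 < a_1 = 1 < a_2 be the first three representatives of the q-cyclotomic cosets modulo N_1 − 1, and set Δ_C = {(0,0),(0,1),(0,2)} and Δ_D = {(0,0),(0,1),(0,2)} ∪ I_{(a_1,0)} ∪ I_{(a_2,0)} ⊆ E_J. Then the reduced Minkowski sum satisfies #\overline{Δ_C + Δ_D} ≤ 6r + 5, the Schur product of the F_q-subfield subcodes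 satisfies dim_{F_q}( S(C^J_{Δ_C}) ⋆ S(C^J_{Δ_D}) ) ≤ 6r + 5, and hence dim_{F_q}( ( S(C^J_{Δ_C}) ⋆ S(C^J_{Δ_D}) )^⊥ ) ≥ n_J − (6r + 5). -/
attribute [local instance] Classical.propDecidable

open scoped Pointwise

noncomputable section

theorem barJ_empty_apply (m : ℕ) (N : Fin m → ℕ) (a : Fin m → ℕ) (j : Fin m) :
    barJ m N ∅ a j = if a j = 0 then 0 else (a j - 1) % (N j - 1) + 1 := by
  simp [barJ]

theorem barJ_empty_add_barJ_of_eq_zero {m : ℕ} {N : Fin m → ℕ} {u v : Fin m → ℕ}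
    (h : ∀ j, u j = 0 ∨ v j = 0) :
    barJ m N ∅ (u + barJ m N ∅ v) = barJ m N ∅ (u + v) := by
  ext j
  rcases h j with h | h
  · by_cases hv : v j = 0 <;> simp [barJ_empty_apply, h, hv]
  · simp [barJ_empty_apply, h]

/-- The reduction of a positive exponent only depends on its residue class. -/
theorem barJ_empty_congr {m : ℕ} {N : Fin m → ℕ} {u v : Fin m → ℕ}
    (h : ∀ j, u j = v j ∨ (0 < u j ∧ 0 < v j ∧ u j ≡ v j [MOD N j - 1])) :
    barJ m N ∅ u = barJ m N ∅ v := by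
  ext j
  rcases h j with h | ⟨hu, hv, h⟩
  · simp [barJ_empty_apply, h]
  · have h' : u j - 1 ≡ v j - 1 [MOD N j - 1] := by
      apply Nat.ModEq.add_right_cancel' 1
      rwa [Nat.sub_add_cancel hu, Nat.sub_add_cancel hv]
    rw [barJ_empty_apply, barJ_empty_apply, if_neg hu.ne', if_neg hv.ne', h']

theorem pow_modEq_pow_mod {q r M : ℕ} (hq : 0 < q) (h : M ∣ q ^ r - 1) (i : ℕ) :
    q ^ i ≡ q ^ (i % r) [MOD M] := by
  have h1 : q ^ r ≡ 1 [MOD M] := ((Nat.modEq_iff_dvd' (Nat.pow_pos hq)).2 h).symm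
  conv_lhs => rw [← Nat.mod_add_div i r, pow_add, pow_mul]
  simpa using (h1.pow (i / r)).mul_left (q ^ (i % r))

theorem pow_sub_one_mod_add_one {F : Type} [Field F] {n : ℕ} {x : F} (hn : 1 < n)
    (hx : x ^ n = x) {a : ℕ} (ha : a ≠ 0) : x ^ ((a - 1) % (n - 1) + 1) = x ^ a := by
  rcases eq_or_ne x 0 with rfl | h0
  · simp [ha]
  · have h1 : x ^ (n - 1) = 1 := by
      apply mul_right_cancel₀ h0
      rw [← pow_succ, Nat.sub_add_cancel hn.le, hx, one_mul]
    have h2 : x ^ (a - 1) = x ^ ((a - 1) % (n - 1)) := by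
      conv_lhs => rw [← Nat.mod_add_div (a - 1) (n - 1), pow_add, pow_mul, h1, one_pow, mul_one]
    rw [pow_succ, ← h2, ← pow_succ, Nat.sub_add_cancel (Nat.pos_of_ne_zero ha)]

theorem evJ_empty_barJ (F : Type) [Field F] (m : ℕ) (N : Fin m → ℕ) (hN : ∀ j, 1 < N j)
    (a : Fin m → ℕ) : evJ F m N ∅ (barJ m N ∅ a) = evJ F m N ∅ a := by
  ext P
  refine Finset.prod_congr rfl fun j _ => ?_
  have hP : (P : Fin m → F) j ^ N j = (P : Fin m → F) j := by simpa using P.2 j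
  rw [barJ_empty_apply]
  split_ifs with h
  · rw [h]
  · exact pow_sub_one_mod_add_one (hN j) hP h

theorem CJ_empty_image_barJ (F : Type) [Field F] (m : ℕ) (N : Fin m → ℕ) (hN : ∀ j, 1 < N j)
    (Δ : Set (Fin m → ℕ)) : CJ F m N ∅ (barJ m N ∅ '' Δ) = CJ F m N ∅ Δ := by
  simp only [CJ, Set.image_image, evJ_empty_barJ F m N hN]

theorem mul_mem_CJ {F : Type} [Field F] {m : ℕ} {N : Fin m → ℕ} {J : Set (Fin m)}
    {A B : Set (Fin m → ℕ)} {u v : ZJ F m N J → F} (hu : u ∈ CJ F m N J A)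
    (hv : v ∈ CJ F m N J B) : u * v ∈ CJ F m N J (A + B) := by
  have h := Submodule.mul_mem_mul hu hv
  rw [CJ, CJ, Submodule.span_mul_span] at h
  refine Submodule.span_mono ?_ h
  rintro _ ⟨_, ⟨a, ha, rfl⟩, _, ⟨b, hb, rfl⟩, rfl⟩
  refine ⟨a + b, Set.add_mem_add ha hb, ?_⟩
  ext P
  simp [evJ, pow_add, Finset.prod_mul_distrib]

theorem schur_subfieldSubcode_mem {K F : Type} [Field K] [Field F] [Algebra K F] {m : ℕ}
    {N : Fin m → ℕ} {J : Set (Fin m)} {A B : Set (Fin m → ℕ)} {w : ZJ F m N J → F}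
    (hw : w ∈ schur (subfieldSubcode K (CJ F m N J A)) (subfieldSubcode K (CJ F m N J B))) :
    w ∈ subfieldSubcode K (CJ F m N J (A + B)) := by
  refine Submodule.span_le.2 ?_ hw
  rintro _ ⟨u, hu, v, hv, rfl⟩
  exact ⟨mul_mem_CJ hu.1 hv.1, fun i => Subring.mul_mem _ (hu.2 i) (hv.2 i)⟩

/-- Extension of scalars preserves linear independence of vectors with entries in `K`. -/
theorem linearIndependent_of_forall_mem_range {K F n ι : Type} [Field K] [Field F] [Algebra K F]
    {b : ι → n → F} (hb : LinearIndependent K b)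
    (hK : ∀ j i, b j i ∈ (algebraMap K F).range) : LinearIndependent F b := by
  choose b' hb' using hK
  rw [linearIndependent_iff'] at hb ⊢
  intro s f hf j hj
  rw [← Module.forall_dual_apply_eq_zero_iff K]
  intro φ
  refine hb s (fun j => φ (f j)) ?_ j hj
  ext i
  have h := congrArg φ (congrFun hf i)
  have h2 : ∀ j, φ (f j * b j i) = φ (f j) * b' j i := fun j => by
    rw [← hb', mul_comm, ← Algebra.smul_def, map_smul, smul_eq_mul, mul_comm]
  simp only [Finset.sum_apply, Pi.smul_apply, smul_eq_mul, map_sum, h2, Pi.zero_apply,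
    map_zero] at h
  have h3 := congrArg (algebraMap K F) h
  simpa [Finset.sum_apply, Algebra.smul_def, hb'] using h3

theorem finrank_le_of_le_subfieldSubcode {K F n : Type} [Field K] [Field F] [Algebra K F]
    [FiniteDimensional K F] [Finite n] {C : Submodule F (n → F)} {D : Submodule K (n → F)}
    (h : D ≤ subfieldSubcode K C) : Module.finrank K D ≤ Module.finrank F C := by
  have := Fintype.ofFinite n
  let b := Module.finBasis K D
  have hb : LinearIndependent K (fun j => (b j : n → F)) :=
    b.linearIndependent.map' D.subtype (Submodule.ker_subtype D)
  have hF := linearIndependent_of_forall_mem_range hb fun j => (h (b j).2).2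
  have hC : LinearIndependent F (fun j => (⟨b j, (h (b j).2).1⟩ : C)) :=
    LinearIndependent.of_comp C.subtype hF
  simpa using hC.fintype_card_le_finrank

theorem finrank_CJ_le_ncard (F : Type) [Field F] (m : ℕ) (N : Fin m → ℕ) (J : Set (Fin m))
    {Δ : Set (Fin m → ℕ)} (hΔ : Δ.Finite) : Module.finrank F (CJ F m N J Δ) ≤ Δ.ncard := by
  have := (hΔ.image (evJ F m N J)).fintype
  refine (finrank_span_le_card (R := F) (evJ F m N J '' Δ)).trans ?_
  rw [← Set.ncard_eq_toFinset_card']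
  exact Set.ncard_image_le hΔ

theorem card_sub_finrank_le_finrank_dualK {K F n : Type} [Field K] [Field F] [Algebra K F]
    [FiniteDimensional K F] [Fintype n] {D : Submodule K (n → F)}
    (hD : ∀ v ∈ D, ∀ i, v i ∈ (algebraMap K F).range) :
    Fintype.card n - Module.finrank K D ≤ Module.finrank K (dualK K D) := by
  let b := Module.finBasis K D
  choose b' hb' using fun j => hD (b j) (b j).2
  let L : (n → K) →ₗ[K] (Fin (Module.finrank K D) → K) := Matrix.mulVecLin (Matrix.of b')
  have hL := L.finrank_range_add_finrank_ker
  have hR : Module.finrank K L.range ≤ Module.finrank K D := by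
    simpa using Submodule.finrank_le L.range
  have hn : Module.finrank K (n → K) = Fintype.card n := Module.finrank_fintype_fun_eq_card K
  let φ : (n → K) →ₗ[K] (n → F) := (Algebra.linearMap K F).compLeft n
  have hφ : Function.Injective φ := fun u v huv => funext fun i =>
    (algebraMap K F).injective (congrFun huv i)
  have hmem : L.ker.map φ ≤ dualK K D := by
    rintro _ ⟨v, hv, rfl⟩
    refine ⟨fun i => ⟨v i, rfl⟩, ?_⟩
    have hbv : ∀ j, ∑ i, φ v i * (b j : n → F) i = 0 := fun j => by
      have h := congrArg (algebraMap K F) (congrFun hv j)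
      simpa [L, Matrix.mulVec, dotProduct, hb', φ, mul_comm] using h
    intro c hc
    let ψ : (n → F) →ₗ[F] F := Fintype.linearCombination F (φ v)
    have h0 : (ψ.restrictScalars K).comp D.subtype = 0 :=
      b.ext fun j => by simpa [ψ, Fintype.linearCombination_apply, mul_comm] using hbv j
    have h := LinearMap.congr_fun h0 ⟨c, hc⟩
    simpa [ψ, Fintype.linearCombination_apply, mul_comm] using h
  have h1 := Submodule.finrank_mono hmem
  rw [← (Submodule.equivMapOfInjective φ hφ L.ker).finrank_eq] at h1
  omega

theorem le_card_pow_eq_self {F : Type} [Field F] [Fintype F] {n : ℕ} (hn : 1 < n)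
    (h : n - 1 ∣ Fintype.card F - 1) : n ≤ Nat.card {x : F // x ^ n = x} := by
  obtain ⟨g, hg⟩ := IsCyclic.exists_ofOrder_eq_natCard (α := Fˣ)
  rw [Nat.card_eq_fintype_card, Fintype.card_units] at hg
  obtain ⟨k, hk⟩ := h
  have hcard : 0 < Fintype.card F - 1 := Nat.sub_pos_of_lt Fintype.one_lt_card
  have hprim : IsPrimitiveRoot (g ^ k : Fˣ) (n - 1) :=
    (hg ▸ IsPrimitiveRoot.orderOf g).pow hcard (by rw [hk, mul_comm])
  have hc := (IsPrimitiveRoot.coe_units_iff.2 hprim).card_nthRootsFinset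
  have h0 : (0 : F) ∉ Polynomial.nthRootsFinset (n - 1) (1 : F) := by
    rw [Polynomial.mem_nthRootsFinset (by omega), zero_pow (by omega)]
    exact zero_ne_one
  have hsub : (↑(insert 0 (Polynomial.nthRootsFinset (n - 1) (1 : F))) : Set F)
      ⊆ {x | x ^ n = x} := by
    intro x hx
    rcases Finset.mem_insert.1 (Finset.mem_coe.1 hx) with rfl | hx
    · exact zero_pow (by omega)
    · rw [Polynomial.mem_nthRootsFinset (by omega)] at hx
      show x ^ n = x
      rw [← Nat.sub_add_cancel hn.le, pow_succ, hx, one_mul]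
  have h1 := Set.ncard_le_ncard hsub (Set.toFinite _)
  rw [Set.ncard_coe_finset, Finset.card_insert_of_notMem h0, hc, Nat.sub_add_cancel hn.le] at h1
  exact h1

theorem prod_le_card_ZJ_empty {F : Type} [Field F] [Fintype F] {m : ℕ} {N : Fin m → ℕ}
    (hN : ∀ j, 1 < N j) (h : ∀ j, N j - 1 ∣ Fintype.card F - 1) :
    ∏ j, N j ≤ Fintype.card (ZJ F m N ∅) := by
  let f : (∀ j, {x : F // x ^ N j = x}) → ZJ F m N ∅ :=
    fun P => ⟨fun j => P j, fun j => by simpa using (P j).2⟩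
  have hf : Function.Injective f := fun P Q hPQ => funext fun j =>
    Subtype.ext (congrFun (congrArg Subtype.val hPQ) j)
  rw [← Nat.card_eq_fintype_card]
  refine le_trans ?_ (Nat.card_le_card_of_injective f hf)
  rw [Nat.card_pi]
  exact Finset.prod_le_prod' fun j _ => le_card_pow_eq_self (hN j) (h j)

/-- with `m = 2`, `J = ∅`, ambient field `F = F_{q^r}` and subfield
`K = F_q` (`q > 4`), `N₁ − 1 ∣ q^r − 1`, `N₂ − 1 ∣ q − 1`, and `0 < 1 < a₂` the first
three representatives of the `q`-cyclotomic cosets modulo `N₁ − 1`, set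
`Δ_C = {(0,0),(0,1),(0,2)}` and `Δ_D = Δ_C ∪ I_{(1,0)} ∪ I_{(a₂,0)}`.  Then
`# bar(Δ_C + Δ_D) ≤ 6r + 5`, `dim_K (S(C^J_{Δ_C}) ⋆ S(C^J_{Δ_D})) ≤ 6r + 5`, and
`dim_K ((S(C^J_{Δ_C}) ⋆ S(C^J_{Δ_D}))^⊥) ≥ N₁N₂ − (6r + 5)`. -/
theorem pir_subfield_bounds
    {K F : Type} [Field K] [Fintype K] [Field F] [Fintype F] [Algebra K F]
    (q r : ℕ) (hq : Fintype.card K = q) (hq4 : 4 < q) (hr : 1 ≤ r)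
    (hF : Fintype.card F = q ^ r)
    (N : Fin 2 → ℕ) (hN : ∀ j, 1 < N j)
    (hN1 : (N 0 - 1) ∣ (q ^ r - 1)) (hN2 : (N 1 - 1) ∣ (q - 1))
    (a2 : ℕ) (ha2 : 1 < a2)
    (ha2rep : a2 < N 0 - 1 ∧ ∀ i : ℕ, a2 ≤ a2 * q ^ i % (N 0 - 1))
    (ha2first : ∀ b, 1 < b → b < a2 →
      ¬ (b < N 0 - 1 ∧ ∀ i : ℕ, b ≤ b * q ^ i % (N 0 - 1))) :
    ∀ (J : Set (Fin 2)), J = ∅ →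
    ∀ Icyc : (Fin 2 → ℕ) → Set (Fin 2 → ℕ),
      (Icyc = fun a => {b | ∃ i : ℕ, b = barJ 2 N J (fun j => q ^ i * a j)}) →
    ∀ ΔC ΔD : Set (Fin 2 → ℕ),
      ΔC = ({![0,0], ![0,1], ![0,2]} : Set (Fin 2 → ℕ)) →
      ΔD = ΔC ∪ Icyc ![1,0] ∪ Icyc ![a2,0] →
    (barJ 2 N J '' (ΔC + ΔD)).ncard ≤ 6 * r + 5 ∧
    Module.finrank K
      ↥(schur (subfieldSubcode K (CJ F 2 N J ΔC)) (subfieldSubcode K (CJ F 2 N J ΔD)))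
        ≤ 6 * r + 5 ∧
    N 0 * N 1 - (6 * r + 5) ≤
      Module.finrank K
        ↥(dualK K
          (schur (subfieldSubcode K (CJ F 2 N J ΔC)) (subfieldSubcode K (CJ F 2 N J ΔD)))) := by
  rintro J rfl Icyc rfl ΔC ΔD hC hD
  have hq0 : 0 < q := by omega
  have key : ∀ a : ℕ, 0 < a → ∀ i y : ℕ,
      barJ 2 N ∅ (![0, y] + barJ 2 N ∅ (fun j => q ^ i * (![a, 0] : Fin 2 → ℕ) j))
        = barJ 2 N ∅ ![q ^ (i % r) * a, y] := by
    intro a ha i y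
    rw [barJ_empty_add_barJ_of_eq_zero (by simp [Fin.forall_fin_two])]
    apply barJ_empty_congr
    rw [Fin.forall_fin_two]
    refine ⟨Or.inr ⟨?_, ?_, ?_⟩, Or.inl (by simp)⟩
    · simpa using ⟨Nat.pow_pos (n := i) hq0, ha⟩
    · simpa using ⟨Nat.pow_pos hq0, ha⟩
    · simpa using (pow_modEq_pow_mod hq0 hN1 i).mul_right a
  let T : ℕ → Finset (Fin 2 → ℕ) := fun a =>
    (Finset.range r ×ˢ Finset.range 3).image fun p => barJ 2 N ∅ ![q ^ p.1 * a, p.2]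
  have hT : ∀ a, (T a).card ≤ 3 * r := fun a =>
    Finset.card_image_le.trans (by simp [mul_comm])
  let U : Finset (Fin 2 → ℕ) := (Finset.range 5).image fun y => barJ 2 N ∅ ![0, y]
  have hU : U.card ≤ 5 := Finset.card_image_le.trans (by simp)
  have hCmem : ∀ u ∈ ΔC, ∃ y < 3, u = ![0, y] := by
    rw [hC]
    rintro u (rfl | rfl | rfl)
    exacts [⟨0, by simp, rfl⟩, ⟨1, by simp, rfl⟩, ⟨2, by simp, rfl⟩]
  have hTmem : ∀ a, 0 < a → ∀ i, ∀ y < 3,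
      barJ 2 N ∅ (![0, y] + barJ 2 N ∅ (fun j => q ^ i * (![a, 0] : Fin 2 → ℕ) j)) ∈ T a := by
    intro a ha i y hy
    rw [key a ha]
    exact Finset.mem_image.2 ⟨(i % r, y), by simp [hy, Nat.mod_lt i hr], rfl⟩
  have hsub : barJ 2 N ∅ '' (ΔC + ΔD) ⊆ ↑(U ∪ T 1 ∪ T a2) := by
    rintro _ ⟨_, ⟨u, hu, v, hv, rfl⟩, rfl⟩
    obtain ⟨y, hy, rfl⟩ := hCmem u hu
    rw [hD] at hv
    rw [Finset.mem_coe, Finset.mem_union, Finset.mem_union]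
    rcases hv with (hv | ⟨i, rfl⟩) | ⟨i, rfl⟩
    · obtain ⟨z, hz, rfl⟩ := hCmem v hv
      exact Or.inl (Or.inl (Finset.mem_image.2 ⟨y + z, Finset.mem_range.2 (by omega), by simp⟩))
    · exact Or.inl (Or.inr (hTmem 1 one_pos i y hy))
    · exact Or.inr (hTmem a2 (by omega) i y hy)
  have hfin : (barJ 2 N ∅ '' (ΔC + ΔD)).Finite := (Finset.finite_toSet _).subset hsub
  have h1 : (barJ 2 N ∅ '' (ΔC + ΔD)).ncard ≤ 6 * r + 5 := by
    refine (Set.ncard_le_ncard hsub (Finset.finite_toSet _)).trans ?_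
    rw [Set.ncard_coe_finset]
    have := Finset.card_union_le (U ∪ T 1) (T a2)
    have := Finset.card_union_le U (T 1)
    have := hT 1
    have := hT a2
    omega
  have h2 : Module.finrank K (schur (subfieldSubcode K (CJ F 2 N ∅ ΔC))
      (subfieldSubcode K (CJ F 2 N ∅ ΔD))) ≤ 6 * r + 5 := by
    refine (finrank_le_of_le_subfieldSubcode fun w hw => schur_subfieldSubcode_mem hw).trans ?_
    rw [← CJ_empty_image_barJ F 2 N hN]
    exact (finrank_CJ_le_ncard F 2 N ∅ hfin).trans h1
  refine ⟨h1, h2, ?_⟩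
  have hcard : N 0 * N 1 ≤ Fintype.card (ZJ F 2 N ∅) := by
    rw [← Fin.prod_univ_two]
    refine prod_le_card_ZJ_empty hN (Fin.forall_fin_two.2 ⟨hF ▸ hN1, hF ▸ hN2.trans ?_⟩)
    simpa using Nat.sub_dvd_pow_sub_pow q 1 r
  exact (tsub_le_tsub hcard h2).trans
    (card_sub_finrank_le_finrank_dualK fun v hv => (schur_subfieldSubcode_mem hv).2)

end
end

section
/- Let q be a prime power, F_{q'} a subfield of F_q, m ≥ 1, N_j > 1 with N_j − 1 dividing q − 1 for j = 1,…,m, and J ⊆ {1,…,m}. For any Δ ⊆ E_J, the dimension of the subfield subcode of the J-affine variety code satisfies dim_{F_{q'}}( S(C^J_Δ) ) = #Δ^σ, where Δ^σ is the union of all minimal cyclotomic sets (with respect to F_{q'}) that are entirely contained in Δ. -/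
attribute [local instance] Classical.propDecidable

open scoped Pointwise

noncomputable section

section SubfieldVectors

variable {K F n : Type} [Field K] [Field F] [Algebra K F]

/-- Vectors with entries in a subfield that are independent over the subfield stay independent
over the whole field. -/
theorem LinearIndependent.extend_of_mem_range {ι : Type*} {v : ι → n → F}
    (hv : LinearIndependent K v) (hK : ∀ k i, v k i ∈ (algebraMap K F).range) :
    LinearIndependent F v := by
  choose u hu using hK
  rw [linearIndependent_iff'] at hv ⊢
  intro s f hf k hk
  let b := Module.Basis.ofVectorSpace K F
  refine (b.forall_coord_eq_zero_iff).1 fun j => ?_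
  refine hv s (fun k => b.coord j (f k)) ?_ k hk
  ext i
  have h := congrArg (b.coord j) (congrFun hf i)
  simp only [Finset.sum_apply, Pi.smul_apply, smul_eq_mul, ← hu, Pi.zero_apply, map_zero,
    map_sum] at h
  simp only [Finset.sum_apply, Pi.smul_apply, ← hu, Pi.zero_apply]
  have h' := congrArg (algebraMap K F) h
  rw [map_sum, map_zero] at h'
  rw [← h']
  refine Finset.sum_congr rfl fun k _ => ?_
  rw [mul_comm, ← Algebra.smul_def, map_smul, smul_eq_mul, map_mul, Algebra.smul_def, mul_comm]

theorem finrank_span_of_mem_range [Finite F] [Finite n] (W : Submodule K (n → F))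
    (hW : ∀ v ∈ W, ∀ i, v i ∈ (algebraMap K F).range) :
    Module.finrank F (Submodule.span F (W : Set (n → F))) = Module.finrank K W := by
  have : Module.Finite K F := Module.Finite.of_finite
  let b := Module.finBasis K W
  have hK : LinearIndependent K fun k => (b k : n → F) :=
    b.linearIndependent.map' W.subtype W.ker_subtype
  have hF := hK.extend_of_mem_range fun k => hW _ (b k).2
  have hspan : Submodule.span F (W : Set (n → F)) =
      Submodule.span F (Set.range fun k => (b k : n → F)) := by
    refine le_antisymm (Submodule.span_le.2 fun w hw => ?_) (Submodule.span_mono ?_)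
    · have h := congrArg W.subtype (b.sum_repr ⟨w, hw⟩)
      simp only [map_sum, map_smul, Submodule.subtype_apply] at h
      rw [← h]
      refine Submodule.sum_mem _ fun k _ => ?_
      rw [← algebraMap_smul F]
      exact Submodule.smul_mem _ _ (Submodule.subset_span ⟨k, rfl⟩)
    · rintro _ ⟨k, rfl⟩
      exact (b k).2
  rw [hspan, finrank_span_eq_card hF, Fintype.card_fin]

/-- A vector is an `F`-combination of the traces of its multiples. -/
theorem mem_span_range_trace_mul [FiniteDimensional K F] [Algebra.IsSeparable K F] (w : n → F) :
    w ∈ Submodule.span F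
      (Set.range fun c : F => fun i => algebraMap K F (Algebra.trace K F (c * w i))) := by
  let b := Module.finBasis K F
  have h : w = ∑ k, b.traceDual k •
      (fun i => algebraMap K F (Algebra.trace K F (b k * w i))) := by
    ext i
    rw [Finset.sum_apply]
    conv_lhs => rw [← b.traceDual.sum_repr (w i)]
    refine Finset.sum_congr rfl fun k _ => ?_
    rw [Module.Basis.traceDual_repr_apply, Algebra.traceForm_apply, Algebra.smul_def, mul_comm,
      mul_comm (w i), Pi.smul_apply, smul_eq_mul]
  have hmem : ∑ k, b.traceDual k • (fun i => algebraMap K F (Algebra.trace K F (b k * w i))) ∈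
      Submodule.span F
        (Set.range fun c : F => fun i => algebraMap K F (Algebra.trace K F (c * w i))) :=
    Submodule.sum_mem _ fun k _ => Submodule.smul_mem _ _ (Submodule.subset_span ⟨b k, rfl⟩)
  rwa [← h] at hmem

theorem frobeniusAlgHom_pow_apply {R : Type*} [Fintype K] [CommRing R] [Algebra K R] (i : ℕ)
    (x : R) : (FiniteField.frobeniusAlgHom K R ^ i) x = x ^ Fintype.card K ^ i := by
  rw [AlgHom.coe_pow, FiniteField.coe_frobeniusAlgHom, pow_iterate]

theorem sum_smul_pow_card_pow {R ι : Type*} [Fintype K] [CommRing R] [Algebra F R] (i : ℕ)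
    (s : Finset ι) (c : ι → F) (v : ι → R) :
    (∑ a ∈ s, c a • v a) ^ Fintype.card K ^ i =
      ∑ a ∈ s, c a ^ Fintype.card K ^ i • v a ^ Fintype.card K ^ i := by
  let _ : Algebra K R := ((algebraMap F R).comp (algebraMap K F)).toAlgebra
  rw [← frobeniusAlgHom_pow_apply (K := K), map_sum]
  refine Finset.sum_congr rfl fun a _ => ?_
  rw [frobeniusAlgHom_pow_apply, smul_pow]

end SubfieldVectors

theorem FiniteField.exists_finset_pow_eq_one {F : Type*} [Field F] [Fintype F] {n : ℕ}
    (hn : 0 < n) (hdiv : n ∣ Fintype.card F - 1) :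
    ∃ S : Finset F, S.card = n ∧ ∀ x ∈ S, x ^ n = 1 := by
  obtain ⟨g, hg⟩ := IsCyclic.exists_ofOrder_eq_natCard (α := Fˣ)
  rw [Nat.card_eq_fintype_card, Fintype.card_units] at hg
  obtain ⟨k, hk⟩ := hdiv
  have hcard : 0 < Fintype.card F - 1 := Nat.sub_pos_of_lt Fintype.one_lt_card
  have hprim : IsPrimitiveRoot (g : F) (Fintype.card F - 1) :=
    IsPrimitiveRoot.coe_units_iff.2 (hg ▸ IsPrimitiveRoot.orderOf g)
  have hroot := hprim.pow hcard (hk.trans (mul_comm n k))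
  exact ⟨Polynomial.nthRootsFinset n 1, hroot.card_nthRootsFinset,
    fun x hx => (Polynomial.mem_nthRootsFinset hn 1).1 hx⟩

section Affine

variable {F : Type} [Field F] {m : ℕ} {N : Fin m → ℕ} {J : Set (Fin m)}

theorem barJ_eq_self (hN : ∀ j, 1 < N j) {a : Fin m → ℕ} (ha : a ∈ EJ m N J) :
    barJ m N J a = a := by
  funext j
  have hj := hN j
  have haj := ha j
  simp only [barJ]
  split_ifs at haj ⊢ with h1 h2
  · exact Nat.mod_eq_of_lt (by omega)
  · exact h2.symm
  · rw [Nat.mod_eq_of_lt (by omega)]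
    omega

theorem evJ_pow (a : Fin m → ℕ) (k : ℕ) :
    evJ F m N J a ^ k = evJ F m N J (fun j => k * a j) := by
  funext P
  simp only [evJ, Pi.pow_apply, ← Finset.prod_pow, ← pow_mul, mul_comm]

theorem exists_finset_subset_ZJ [Fintype F] (hN : ∀ j, 1 < N j)
    (hdiv : ∀ j, (N j - 1) ∣ (Fintype.card F - 1)) :
    ∃ S : Fin m → Finset F, (∀ P : Fin m → F, (∀ j, P j ∈ S j) → P ∈ ZJ F m N J) ∧
      ∀ j, (if j ∈ J then N j - 2 else N j - 1) < (S j).card := by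
  have key : ∀ j, ∃ S : Finset F,
      (∀ x ∈ S, if j ∈ J then x ^ (N j - 1) = 1 else x ^ (N j) = x) ∧
      (if j ∈ J then N j - 2 else N j - 1) < S.card := by
    intro j
    have hj := hN j
    obtain ⟨S, hS, hS1⟩ := FiniteField.exists_finset_pow_eq_one (by omega) (hdiv j)
    split_ifs with h
    · exact ⟨S, hS1, by omega⟩
    · refine ⟨insert 0 S, fun x hx => ?_, ?_⟩
      · rcases Finset.mem_insert.1 hx with rfl | hx
        · exact zero_pow (by omega)
        · calc x ^ N j = x ^ (N j - 1) * x := by rw [← pow_succ, Nat.sub_add_cancel hj.le]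
            _ = x := by rw [hS1 x hx, one_mul]
      · rw [Finset.card_insert_of_notMem, hS]
        · omega
        · intro h0
          have := hS1 0 h0
          rw [zero_pow (by omega)] at this
          exact zero_ne_one this
  choose S hS using key
  exact ⟨S, fun P hP j => (hS j).1 _ (hP j), fun j => (hS j).2⟩

theorem linearIndepOn_evJ [Fintype F] (hN : ∀ j, 1 < N j)
    (hdiv : ∀ j, (N j - 1) ∣ (Fintype.card F - 1)) :
    LinearIndepOn F (evJ F m N J) (EJ m N J) := by
  obtain ⟨S, hSZ, hScard⟩ := exists_finset_subset_ZJ (J := J) hN hdiv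
  let eval : MvPolynomial (Fin m) F →ₗ[F] (ZJ F m N J → F) :=
    LinearMap.pi fun P => (MvPolynomial.aeval (P : Fin m → F)).toLinearMap
  let mon : EJ m N J → MvPolynomial (Fin m) F := fun a =>
    MvPolynomial.basisMonomials (Fin m) F (Finsupp.equivFunOnFinite.symm a)
  have hmon : LinearIndependent F mon :=
    (MvPolynomial.basisMonomials (Fin m) F).linearIndependent.comp
      (fun a : EJ m N J => Finsupp.equivFunOnFinite.symm (a : Fin m → ℕ))
      (Finsupp.equivFunOnFinite.symm.injective.comp Subtype.val_injective)
  have hdeg : ∀ p ∈ Submodule.span F (Set.range mon), ∀ j, p.degreeOf j < (S j).card := by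
    intro p hp j
    induction hp using Submodule.span_induction with
    | mem p hp =>
      obtain ⟨a, rfl⟩ := hp
      simp only [mon, MvPolynomial.coe_basisMonomials]
      rw [MvPolynomial.degreeOf_monomial_eq _ _ one_ne_zero]
      exact (a.2 j).trans_lt (hScard j)
    | zero =>
      rw [MvPolynomial.degreeOf_zero]
      exact (Nat.zero_le _).trans_lt (hScard j)
    | add p r _ _ hp hr => exact (MvPolynomial.degreeOf_add_le j p r).trans_lt (max_lt hp hr)
    | smul c p _ hp =>
      rw [MvPolynomial.smul_eq_C_mul]
      exact (MvPolynomial.degreeOf_C_mul_le p j c).trans_lt hp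
  have hind : LinearIndependent F (eval ∘ mon) := by
    refine hmon.map (Submodule.disjoint_def.2 fun p hp h0 => ?_)
    refine MvPolynomial.eq_zero_of_eval_zero_at_prod_finset p S (hdeg p hp) fun x hx => ?_
    exact congrFun (LinearMap.mem_ker.1 h0) ⟨x, hSZ x hx⟩
  have hev : (fun a : EJ m N J => evJ F m N J a) = eval ∘ mon := by
    funext a P
    simp [eval, mon, evJ, MvPolynomial.aeval_monomial, Finsupp.prod_fintype]
  rwa [← hev] at hind

theorem finrank_span_evJ [Fintype F] (hN : ∀ j, 1 < N j)
    (hdiv : ∀ j, (N j - 1) ∣ (Fintype.card F - 1)) {D : Set (Fin m → ℕ)} (hD : D ⊆ EJ m N J) :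
    Module.finrank F (CJ F m N J D) = D.ncard := by
  have hind : LinearIndependent F (fun a : D => evJ F m N J a) :=
    (linearIndepOn_evJ hN hdiv).mono hD
  have : Finite D := hind.finite
  have : Fintype D := Fintype.ofFinite D
  rw [CJ, Set.image_eq_range, finrank_span_eq_card hind, ← Nat.card_coe_set_eq,
    Nat.card_eq_fintype_card]

variable {K : Type} [Field K] [Fintype K] [Algebra K F] {Δ : Set (Fin m → ℕ)}

theorem injOn_barJ_card_pow_mul [Fintype F] (hN : ∀ j, 1 < N j)
    (hdiv : ∀ j, (N j - 1) ∣ (Fintype.card F - 1)) (i : ℕ) :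
    Set.InjOn (fun a : Fin m → ℕ => barJ m N J fun j => Fintype.card K ^ i * a j)
      (EJ m N J) := by
  intro a ha b hb hab
  have h := congrArg (evJ F m N J) hab
  simp only [evJ_barJ hN, ← evJ_pow] at h
  refine (linearIndepOn_evJ hN hdiv).injOn ha hb (funext fun P => ?_)
  have hinj : Function.Injective (FiniteField.frobeniusAlgHom K F ^ i) :=
    (FiniteField.frobeniusAlgHom K F ^ i).toRingHom.injective
  refine hinj ?_
  rw [frobeniusAlgHom_pow_apply, frobeniusAlgHom_pow_apply]
  exact congrFun h P

/-- Coefficients of a codeword with entries in `K` are permuted by the Frobenius action. -/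
theorem subfieldSubcode_le_span_evJ [Fintype F] (hN : ∀ j, 1 < N j)
    (hdiv : ∀ j, (N j - 1) ∣ (Fintype.card F - 1)) (hΔ : Δ ⊆ EJ m N J)
    {v : ZJ F m N J → F} (hv : v ∈ subfieldSubcode K (CJ F m N J Δ)) :
    v ∈ CJ F m N J
      {a | a ∈ EJ m N J ∧ ∀ i, barJ m N J (fun j => Fintype.card K ^ i * a j) ∈ Δ} := by
  obtain ⟨hvC, hvK⟩ := hv
  obtain ⟨l, hl, rfl⟩ := (Finsupp.mem_span_image_iff_linearCombination F).1 hvC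
  rw [Finsupp.mem_supported] at hl
  refine (Finsupp.mem_span_image_iff_linearCombination F).2 ⟨l, ?_, rfl⟩
  rw [Finsupp.mem_supported]
  intro a ha
  refine ⟨hΔ (hl ha), fun i => hl ?_⟩
  have hfix : (Finsupp.linearCombination F (evJ F m N J) l) ^ Fintype.card K ^ i =
      Finsupp.linearCombination F (evJ F m N J) l := by
    funext P
    obtain ⟨x, hx⟩ := hvK P
    rw [Pi.pow_apply, ← hx, ← map_pow, FiniteField.pow_card_pow]
  rw [Finsupp.linearCombination_apply, Finsupp.sum, sum_smul_pow_card_pow] at hfix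
  have hinj := injOn_barJ_card_pow_mul (K := K) (J := J) hN hdiv i
  have hq : Fintype.card K ^ i ≠ 0 := pow_ne_zero _ Fintype.card_ne_zero
  generalize Fintype.card K ^ i = q at hfix hinj hq ⊢
  set π : (Fin m → ℕ) → (Fin m → ℕ) := fun a => barJ m N J fun j => q * a j with hπ
  obtain ⟨l₁, hl₁⟩ : ∃ l₁ : (Fin m → ℕ) →₀ F, ∀ a, l₁ a = l a ^ q :=
    ⟨l.mapRange (· ^ q) (zero_pow hq), fun a => rfl⟩
  have hsub : l₁.support ⊆ l.support := fun b hb => by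
    rw [Finsupp.mem_support_iff, hl₁] at hb
    exact Finsupp.mem_support_iff.2 fun h0 => hb (by rw [h0, zero_pow hq])
  have hcomb : Finsupp.linearCombination F (evJ F m N J) (l₁.mapDomain π) =
      Finsupp.linearCombination F (evJ F m N J) l := by
    rw [Finsupp.linearCombination_mapDomain, Finsupp.linearCombination_apply,
      Finsupp.linearCombination_apply, Finsupp.sum_of_support_subset l₁ hsub _
      (fun a _ => zero_smul F ((evJ F m N J ∘ π) a)), Finsupp.sum, ← hfix]
    refine Finset.sum_congr rfl fun b _ => ?_
    rw [hl₁, evJ_pow, Function.comp_apply, hπ, evJ_barJ hN]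
  have hsupp : l₁.mapDomain π ∈ Finsupp.supported F F (EJ m N J) :=
    Submodule.sum_mem _ fun b _ => Finsupp.single_mem_supported F _ (barJ_mem_EJ hN _)
  have heq : l₁.mapDomain π = l :=
    linearIndepOn_iffₛ.1 (linearIndepOn_evJ hN hdiv) _ hsupp _
      ((Finsupp.mem_supported _ _).2 (hl.trans hΔ)) hcomb
  have hval : l (π a) = l a ^ q := by
    rw [← DFunLike.congr_fun heq (π a), Finsupp.mapDomain_apply' (EJ m N J) l₁
      (fun b hb => hΔ (hl (hsub hb))) hinj (hΔ (hl ha)), hl₁]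
  refine Finsupp.mem_support_iff.2 ?_
  rw [hval]
  exact pow_ne_zero _ (Finsupp.mem_support_iff.1 ha)

theorem evJ_mem_span_subfieldSubcode [Fintype F] (hN : ∀ j, 1 < N j) {a : Fin m → ℕ} {k : ℕ}
    (ha : ∀ i, barJ m N J (fun j => Fintype.card K ^ i * a j) ∈ Δ) :
    evJ F m N J (barJ m N J fun j => Fintype.card K ^ k * a j) ∈
      Submodule.span F (subfieldSubcode K (CJ F m N J Δ) : Set (ZJ F m N J → F)) := by
  have : Module.Finite K F := Module.Finite.of_finite
  refine Submodule.span_mono ?_ (mem_span_range_trace_mul (K := K) _)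
  rintro _ ⟨c, rfl⟩
  refine ⟨?_, fun P => ⟨_, rfl⟩⟩
  have h : (fun P : ZJ F m N J => algebraMap K F (Algebra.trace K F
        (c * evJ F m N J (barJ m N J fun j => Fintype.card K ^ k * a j) P))) =
      ∑ i ∈ Finset.range (Module.finrank K F), c ^ Fintype.card K ^ i •
        evJ F m N J (barJ m N J fun j => Fintype.card K ^ (i + k) * a j) := by
    funext P
    rw [FiniteField.algebraMap_trace_eq_sum_pow, Finset.sum_apply, Nat.card_eq_fintype_card]
    refine Finset.sum_congr rfl fun i _ => ?_
    rw [mul_pow, Pi.smul_apply, smul_eq_mul, ← Pi.pow_apply, evJ_barJ hN, evJ_barJ hN]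
    simp only [pow_add, mul_assoc, ← evJ_pow, Pi.pow_apply]
  refine Set.mem_of_eq_of_mem h ?_
  exact Submodule.sum_mem _ fun i _ =>
    Submodule.smul_mem _ _ (Submodule.subset_span ⟨_, ha (i + k), rfl⟩)

end Affine

/-- the dimension over the subfield `F_{q'} = K` of the subfield
subcode of a `J`-affine variety code equals `#Δ^σ`, where `Δ^σ` is the union of
all minimal cyclotomic sets (with respect to `F_{q'}`) entirely contained in `Δ`. -/
theorem finrank_subfieldSubcode_eq
    {K F : Type} [Field K] [Fintype K] [Field F] [Fintype F] [Algebra K F]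
    (m : ℕ) (hm : 1 ≤ m)
    (N : Fin m → ℕ) (hN : ∀ j, 1 < N j)
    (hdiv : ∀ j, (N j - 1) ∣ (Fintype.card F - 1))
    (J : Set (Fin m)) (Δ : Set (Fin m → ℕ)) (hΔ : Δ ⊆ EJ m N J) :
    ∀ Icyc : (Fin m → ℕ) → Set (Fin m → ℕ),
      (Icyc = fun a => {b | ∃ i : ℕ, b = barJ m N J (fun j => (Fintype.card K) ^ i * a j)}) →
    Module.finrank K ↥(subfieldSubcode K (CJ F m N J Δ)) =
      ({b | ∃ a ∈ EJ m N J, Icyc a ⊆ Δ ∧ b ∈ Icyc a} : Set (Fin m → ℕ)).ncard := by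
  rintro Icyc rfl
  set D : Set (Fin m → ℕ) := {b | ∃ a ∈ EJ m N J,
    {b | ∃ i : ℕ, b = barJ m N J (fun j => (Fintype.card K) ^ i * a j)} ⊆ Δ ∧
      b ∈ {b | ∃ i : ℕ, b = barJ m N J (fun j => (Fintype.card K) ^ i * a j)}} with hD
  have hspan : Submodule.span F
      (subfieldSubcode K (CJ F m N J Δ) : Set (ZJ F m N J → F)) = CJ F m N J D := by
    refine le_antisymm (Submodule.span_le.2 fun v hv => ?_) (Submodule.span_le.2 ?_)
    · refine Submodule.span_mono (Set.image_mono ?_) (subfieldSubcode_le_span_evJ hN hdiv hΔ hv)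
      rintro a ⟨ha, hi⟩
      refine ⟨a, ha, ?_, 0, ?_⟩
      · rintro _ ⟨i, rfl⟩
        exact hi i
      · simp only [pow_zero, one_mul]
        exact (barJ_eq_self hN ha).symm
    · rintro _ ⟨_, ⟨a, -, hsub, k, rfl⟩, rfl⟩
      exact evJ_mem_span_subfieldSubcode hN fun i => hsub ⟨i, rfl⟩
  have hDE : D ⊆ EJ m N J := by
    rintro _ ⟨a, -, hsub, hb⟩
    exact hΔ (hsub hb)
  rw [← finrank_span_of_mem_range _ fun v (hv : v ∈ CJ F m N J Δ ∧ _) => hv.2, hspan, finrank_span_evJ hN hdiv hDE]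

end
end
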